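/- arXiv:math/0312095 — 2 statements merged into one kernel-verified Lean document; each statement's English description precedes it below -/
import Mathlib

section
/- Polar decomposition for non-simple polytopes: Let P ⊆ ℚ^d be a full-dimensional polytope. For each vertex v of P choose a regular triangulation Δ_v of the normal cone N_v into simplicial cones, and let ξ ∈ (ℚ^d)^* be generic for all the Δ_v. Then 1_P = Σ_{v vertex of P} 1^ξ_{Δ_v,v}, as functions ℚ^d → ℤ. -/
noncomputable section
open Classical

open scoped BigOperators

/-- Indicator function of a set, with values in `ℤ`. -/
def indicator {d : ℕ} (S : Set (Fin d → ℚ)) (x : Fin d → ℚ) : ℤ :=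
  if x ∈ S then 1 else 0

/-- A polytope is the convex hull of a finite set of points. -/
def IsPolytope {d : ℕ} (P : Set (Fin d → ℚ)) : Prop :=
  ∃ T : Finset (Fin d → ℚ), P = convexHull ℚ (T : Set (Fin d → ℚ))

/-- A face of `P` is the set of maximizers of a linear functional over `P`. -/
def IsFace {d : ℕ} (P F : Set (Fin d → ℚ)) : Prop :=
  ∃ ℓ : Module.Dual ℚ (Fin d → ℚ), F = {x ∈ P | ∀ y ∈ P, ℓ y ≤ ℓ x}

/-- A vertex is a point whose singleton is a face. -/
def IsVertex {d : ℕ} (P : Set (Fin d → ℚ)) (v : Fin d → ℚ) : Prop :=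
  IsFace P {v}

/-- The (inner) normal cone of `P` at `v`, inside the dual space. -/
def normalCone {d : ℕ} (P : Set (Fin d → ℚ)) (v : Fin d → ℚ) :
    Set (Module.Dual ℚ (Fin d → ℚ)) :=
  {n | ∀ x ∈ P, n v ≤ n x}

/-- The simplicial cone in the dual space spanned by `w_1, …, w_d`. -/
def coneOf {d : ℕ} (w : Fin d → Module.Dual ℚ (Fin d → ℚ)) :
    Set (Module.Dual ℚ (Fin d → ℚ)) :=
  {n | ∃ c : Fin d → ℚ, (∀ k, 0 ≤ c k) ∧ n = ∑ k, c k • w k}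

/-- The face of the simplicial cone spanned by `w` where the coordinates in `K`
vanish. -/
def coneFaceOf {d : ℕ} (w : Fin d → Module.Dual ℚ (Fin d → ℚ)) (K : Finset (Fin d)) :
    Set (Module.Dual ℚ (Fin d → ℚ)) :=
  {n | ∃ c : Fin d → ℚ, (∀ k, 0 ≤ c k) ∧ (∀ k ∈ K, c k = 0) ∧ n = ∑ k, c k • w k}

/-- A finite collection of simplicial cones in the dual space, each given by `d`
linearly independent generators. -/
structure SimplicialFamily (d : ℕ) where
  M : ℕ
  w : Fin M → Fin d → Module.Dual ℚ (Fin d → ℚ)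
  indep : ∀ i, LinearIndependent ℚ (w i)

/-- `Δ` is a triangulation of `N`: the cones cover `N` and any two of them intersect
in a common face. -/
def IsTriangulationOf {d : ℕ} (Δ : SimplicialFamily d)
    (N : Set (Module.Dual ℚ (Fin d → ℚ))) : Prop :=
  (⋃ i, coneOf (Δ.w i)) = N ∧
  ∀ i j, ∃ K K' : Finset (Fin d),
    coneOf (Δ.w i) ∩ coneOf (Δ.w j) = coneFaceOf (Δ.w i) K ∧
    coneOf (Δ.w i) ∩ coneOf (Δ.w j) = coneFaceOf (Δ.w j) K'

/-- `Δ` is regular on `N`: there is a convex function on `N` that is linear on each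
cone of `Δ`, with pairwise distinct linear pieces. -/
def IsRegularOn {d : ℕ} (Δ : SimplicialFamily d)
    (N : Set (Module.Dual ℚ (Fin d → ℚ))) : Prop :=
  ∃ h : Module.Dual ℚ (Fin d → ℚ) → ℚ, ConvexOn ℚ N h ∧
    ∃ ℓ : Fin Δ.M → Module.Dual ℚ (Module.Dual ℚ (Fin d → ℚ)),
      (∀ i, ∀ n ∈ coneOf (Δ.w i), h n = ℓ i n) ∧
      ∀ i j, i ≠ j → ℓ i ≠ ℓ j

/-- The polarized cone `T^ξ_v T_σ` for a simplicial cone with generators `w` and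
coordinates `α` of `ξ` in the basis `w`. -/
def polarCone {d : ℕ} (v : Fin d → ℚ) (w : Fin d → Module.Dual ℚ (Fin d → ℚ))
    (α : Fin d → ℚ) : Set (Fin d → ℚ) :=
  {x | ∀ k, (0 < α k → w k v ≤ w k x) ∧ (α k < 0 → w k x < w k v)}

/-- The index: the number of negative coordinates. -/
def indOf {d : ℕ} (α : Fin d → ℚ) : ℕ :=
  (Finset.univ.filter fun k => α k < 0).card

/-- The local contribution `1^ξ_{Δ,v}` at `v`, where `α i` gives the coordinates of
`ξ` in the basis `Δ.w i`. -/
def localContrib {d : ℕ} (Δ : SimplicialFamily d) (v : Fin d → ℚ)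
    (α : Fin Δ.M → Fin d → ℚ) (x : Fin d → ℚ) : ℤ :=
  ∑ i, (-1 : ℤ) ^ indOf (α i) * indicator (polarCone v (Δ.w i) (α i)) x

def phi (c a : ℚ) : ℤ :=
  if 0 ≤ c then (if 0 < a then 1 else 0) else (if a < 0 then -1 else 0)

def SameSign (a b : ℚ) : Prop := (0 < a ↔ 0 < b) ∧ (a < 0 ↔ b < 0)

lemma phi_congr {a b : ℚ} (h : SameSign a b) (c : ℚ) : phi c a = phi c b := by
  simp only [phi, h.1, h.2]

lemma SameSign.ne {a b : ℚ} (h : SameSign a b) (hb : b ≠ 0) : a ≠ 0 := by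
  rcases lt_or_gt_of_ne hb with h1 | h1
  · exact (h.2.2 h1).ne
  · exact (h.1.2 h1).ne'

lemma phi_mul_nonneg {c a : ℚ} (h : phi c a ≠ 0) : 0 ≤ a * c := by
  unfold phi at h
  split_ifs at h with h1 h2 h2
  · positivity
  · simp at h
  · nlinarith
  · simp at h

lemma phi_jump {c a e s t : ℚ} (he : e ≠ 0) (hs : 0 < s) (ht : 0 < t) (ha : a = 0) :
    phi c (a + t * e) - phi c (a - s * e) = if 0 < e then 1 else -1 := by
  subst ha
  rcases lt_or_gt_of_ne he with h1 | h1
  · have h2 : t * e < 0 := by nlinarith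
    have h3 : s * e < 0 := by nlinarith
    unfold phi
    split_ifs <;> linarith
  · have h2 : 0 < t * e := by positivity
    have h3 : 0 < s * e := by positivity
    unfold phi
    split_ifs <;> linarith

lemma facet_basis {n : ℕ} {V : Type} [AddCommGroup V] [Module ℚ V]
    (b : Module.Basis (Fin (n+1)) ℚ V) (k : Fin (n+1)) (H : Submodule ℚ V)
    (hH : ∀ q, q ∈ H ↔ b.repr q k = 0) :
    ∃ b' : Module.Basis (Fin n) ℚ H, (∀ i, (b' i : V) = b (k.succAbove i)) ∧
      ∀ (q : H) i, b'.repr q i = b.repr (q : V) (k.succAbove i) := by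
  have hm : ∀ i, b (k.succAbove i) ∈ H := by
    intro i; rw [hH]; simp [Module.Basis.repr_self]
  let e : H ≃ₗ[ℚ] (Fin n → ℚ) :=
    { toFun := fun q i => b.repr (q : V) (k.succAbove i)
      map_add' := by intro x y; ext i; simp
      map_smul' := by intro x y; ext i; simp
      invFun := fun c => ∑ i, c i • (⟨b (k.succAbove i), hm i⟩ : H)
      left_inv := by
        intro q
        apply Subtype.ext
        have := b.sum_repr (q : V)
        rw [Fin.sum_univ_succAbove _ k, (hH q).1 q.2] at this
        simpa using this
      right_inv := by
        intro c
        ext i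
        simp [Finsupp.single_apply] }
  refine ⟨Module.Basis.ofEquivFun e, ?_, ?_⟩
  · intro i
    simp only [Module.Basis.coe_ofEquivFun, e]
    simp [Pi.single_apply]
  · intro q i
    simp [e]

lemma exists_avoid {V : Type} [AddCommGroup V] [Module ℚ V] (A : Finset (Module.Dual ℚ V))
    (hA : ∀ a ∈ A, a ≠ 0) : ∃ u : V, ∀ a ∈ A, a u ≠ 0 := by
  obtain ⟨u, hu⟩ := Module.Dual.exists_forall_ne_zero_of_forall_exists
    (K := ℚ) (M := V) (fun a : A => (a : Module.Dual ℚ V)) (by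
      intro i
      by_contra hc
      push Not at hc
      exact hA _ i.2 (LinearMap.ext hc))
  exact ⟨u, fun a ha => hu ⟨a, ha⟩⟩

lemma exists_small {V : Type} [AddCommGroup V] [Module ℚ V] (A : Finset (Module.Dual ℚ V))
    (q u : V) : ∃ ε : ℚ, 0 < ε ∧ ∀ a ∈ A, (a q ≠ 0 →
      SameSign (a (q + ε • u)) (a q) ∧ SameSign (a (q - ε • u)) (a q)) := by
  have : ∀ a ∈ A, ∀ᶠ ε : ℚ in nhdsWithin 0 (Set.Ioi 0), (a q ≠ 0 →
      SameSign (a (q + ε • u)) (a q) ∧ SameSign (a (q - ε • u)) (a q)) := by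
    intro a _
    apply eventually_nhdsWithin_of_eventually_nhds
    by_cases h0 : a q = 0
    · simp [h0]
    have c1 : Filter.Tendsto (fun ε : ℚ => a (q + ε • u)) (nhds 0) (nhds (a q)) := by
      have : Continuous (fun ε : ℚ => a q + ε * a u) := by fun_prop
      simpa using this.tendsto 0
    have c2 : Filter.Tendsto (fun ε : ℚ => a (q - ε • u)) (nhds 0) (nhds (a q)) := by
      have : Continuous (fun ε : ℚ => a q - ε * a u) := by fun_prop
      simpa using this.tendsto 0
    rcases lt_or_gt_of_ne h0 with h1 | h1
    · filter_upwards [c1.eventually_lt_const h1, c2.eventually_lt_const h1] with ε e1 e2 _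
      exact ⟨⟨by constructor <;> intro <;> linarith, by tauto⟩,
        ⟨by constructor <;> intro <;> linarith, by tauto⟩⟩
    · filter_upwards [c1.eventually_const_lt h1, c2.eventually_const_lt h1] with ε e1 e2 _
      exact ⟨⟨by tauto, by constructor <;> intro <;> linarith⟩,
        ⟨by tauto, by constructor <;> intro <;> linarith⟩⟩
  have h2 := (Filter.eventually_all_finset A).2 this
  obtain ⟨ε, h, h'⟩ := (h2.and self_mem_nhdsWithin).exists
  exact ⟨ε, h', h⟩

/-- The signed function attached to a basis and a label. -/
def sgf {n : ℕ} {V : Type} [AddCommGroup V] [Module ℚ V]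
    (b : Module.Basis (Fin n) ℚ V) (y : V →ₗ[ℚ] ℚ) (q : V) : ℤ :=
  ∏ k, phi (y (b k)) (b.repr q k)

lemma sgf_eq_zero {n : ℕ} {V : Type} [AddCommGroup V] [Module ℚ V]
    (b : Module.Basis (Fin n) ℚ V) (y : V →ₗ[ℚ] ℚ) (q : V) (h : y q < 0) : sgf b y q = 0 := by
  by_contra h0
  have h1 := Finset.prod_ne_zero_iff.1 h0
  have : y q = ∑ k, b.repr q k * y (b k) := by
    conv_lhs => rw [← b.sum_repr q, map_sum]
    simp only [map_smul, smul_eq_mul]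
  rw [this] at h
  exact absurd h (not_lt.2 (Finset.sum_nonneg fun k hk => phi_mul_nonneg (h1 k hk)))

lemma sgf_congr {n : ℕ} {V : Type} [AddCommGroup V] [Module ℚ V]
    (b : Module.Basis (Fin n) ℚ V) (y : V →ₗ[ℚ] ℚ) (q r : V)
    (h : ∀ k, SameSign (b.repr q k) (b.repr r k)) : sgf b y q = sgf b y r :=
  Finset.prod_congr rfl fun k _ => phi_congr (h k) _

/-- Jump of one signed function across a wall. -/
lemma sgf_jump {n : ℕ} {V : Type} [AddCommGroup V] [Module ℚ V]
    (b : Module.Basis (Fin (n+1)) ℚ V) (y : V →ₗ[ℚ] ℚ) (k : Fin (n+1)) (H : Submodule ℚ V)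
    (b' : Module.Basis (Fin n) ℚ H) (hb' : ∀ i, (b' i : V) = b (k.succAbove i))
    (hr : ∀ (q : H) i, b'.repr q i = b.repr (q : V) (k.succAbove i))
    (q : H) (η : V) (s t : ℚ) (hs : 0 < s) (ht : 0 < t) (hk : b.repr (q : V) k = 0)
    (hη : b.repr η k ≠ 0)
    (h1 : ∀ i, SameSign (b.repr ((q : V) + t • η) (k.succAbove i))
      (b.repr (q : V) (k.succAbove i)))
    (h2 : ∀ i, SameSign (b.repr ((q : V) - s • η) (k.succAbove i))
      (b.repr (q : V) (k.succAbove i))) :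
    sgf b y ((q : V) + t • η) - sgf b y ((q : V) - s • η) =
      (if 0 < b.repr η k then 1 else -1) * sgf b' (y ∘ₗ H.subtype) q := by
  unfold sgf
  rw [Fin.prod_univ_succAbove _ k, Fin.prod_univ_succAbove _ k]
  simp_rw [fun i => phi_congr (h1 i), fun i => phi_congr (h2 i)]
  rw [← sub_mul]
  congr 1
  · rw [← phi_jump (c := y (b k)) hη hs ht hk]
    simp
  · refine Finset.prod_congr rfl fun i _ => ?_
    simp [hr, hb']

lemma family_jump {n : ℕ} {V : Type} [AddCommGroup V] [Module ℚ V] {J : Type} [Fintype J]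
    (c : J → ℤ) (b : J → Module.Basis (Fin (n+1)) ℚ V) (y : V →ₗ[ℚ] ℚ) (H : Submodule ℚ V)
    (S : J → Prop) (kk : {j // S j} → Fin (n+1))
    (b' : {j // S j} → Module.Basis (Fin n) ℚ H)
    (hb' : ∀ j i, (b' j i : V) = b j ((kk j).succAbove i))
    (hr : ∀ j (q : H) i, (b' j).repr q i = (b j).repr (q : V) ((kk j).succAbove i))
    (q : H) (η : V) (s t : ℚ) (hs : 0 < s) (ht : 0 < t)
    (hk : ∀ j : {j // S j}, (b j).repr (q : V) (kk j) = 0)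
    (hη : ∀ j : {j // S j}, (b j).repr η (kk j) ≠ 0)
    (h : ∀ j k, (b j).repr (q : V) k ≠ 0 →
      SameSign ((b j).repr ((q : V) + t • η) k) ((b j).repr (q : V) k) ∧
      SameSign ((b j).repr ((q : V) - s • η) k) ((b j).repr (q : V) k))
    (hS1 : ∀ j : {j // S j}, ∀ i, (b j).repr (q : V) ((kk j).succAbove i) ≠ 0)
    (hS2 : ∀ j, ¬ S j → ∀ k, (b j).repr (q : V) k ≠ 0) :
    (∑ j, c j * sgf (b j) y ((q : V) + t • η)) - ∑ j, c j * sgf (b j) y ((q : V) - s • η) =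
      ∑ j : {j // S j}, (c j * (if 0 < (b j).repr η (kk j) then 1 else -1)) *
        sgf (b' j) (y ∘ₗ H.subtype) q := by
  rw [← Finset.sum_sub_distrib, ← Fintype.sum_subtype_add_sum_subtype S]
  have h0 : ∑ j : {j // ¬ S j}, (c j * sgf (b j) y ((q : V) + t • η) -
      c j * sgf (b j) y ((q : V) - s • η)) = 0 := by
    refine Finset.sum_eq_zero fun j _ => ?_
    rw [sgf_congr (b j) y _ _ fun k => (h j k (hS2 j j.2 k)).1,
      sgf_congr (b j) y _ _ fun k => (h j k (hS2 j j.2 k)).2, sub_self]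
  rw [h0, add_zero]
  refine Finset.sum_congr rfl fun j _ => ?_
  rw [← mul_sub, mul_assoc]
  congr 1
  exact sgf_jump (b j) y (kk j) H (b' j) (hb' j) (hr j) q η s t hs ht (hk j) (hη j)
    (fun i => (h j _ (hS1 j i)).1) (fun i => (h j _ (hS1 j i)).2)

/-- The valuation property of the signed functions. -/
def ZStmt (n : ℕ) : Prop :=
  ∀ (V : Type) [AddCommGroup V] [Module ℚ V] (J : Type) [Fintype J]
    (c : J → ℤ) (b : J → Module.Basis (Fin n) ℚ V) (y : V →ₗ[ℚ] ℚ)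
    (A : Finset (Module.Dual ℚ V)), (∀ a ∈ A, a ≠ 0) →
    (∀ q, (∀ a ∈ A, a q ≠ 0) → ∑ j, c j * sgf (b j) 0 q = 0) →
    ∀ ξ, (∀ j k, (b j).repr ξ k ≠ 0) → ∑ j, c j * sgf (b j) y ξ = 0

lemma ZStmt_zero : ZStmt 0 := by
  intro V _ _ J _ c b y A hA h ξ _
  obtain ⟨u, hu⟩ := exists_avoid A hA
  simpa [sgf] using h u hu

/-- Crossing of one wall. -/
lemma cross {n : ℕ} (hZ : ZStmt n) {V : Type} [AddCommGroup V] [Module ℚ V] {J : Type} [Fintype J]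
    (c : J → ℤ) (b : J → Module.Basis (Fin (n+1)) ℚ V) (y : V →ₗ[ℚ] ℚ)
    (A : Finset (Module.Dual ℚ V)) (hcoord : ∀ j k, (b j).coord k ∈ A)
    (hvan : ∀ q, (∀ a ∈ A, a q ≠ 0) → ∑ j, c j * sgf (b j) 0 q = 0)
    (p η : V) (s t : ℚ) (hs : 0 < s) (ht : 0 < t)
    (a0 : Module.Dual ℚ V) (hp0 : a0 p = 0)
    (hprop : ∀ a ∈ A, a p = 0 → ∃ l : ℚ, l ≠ 0 ∧ a = l • a0)
    (hη : a0 η ≠ 0)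
    (hss : ∀ a ∈ A, a p ≠ 0 → SameSign (a (p + t • η)) (a p) ∧ SameSign (a (p - s • η)) (a p)) :
    ∑ j, c j * sgf (b j) y (p + t • η) = ∑ j, c j * sgf (b j) y (p - s • η) := by
  let H : Submodule ℚ V := LinearMap.ker a0
  have hpH : p ∈ H := hp0
  obtain ⟨S, hS⟩ : ∃ S : J → Prop, ∀ j, S j ↔ ∃ k, (b j).repr p k = 0 := ⟨_, fun _ => Iff.rfl⟩
  choose kk hkk using fun j : {j // S j} => (hS j).1 j.2
  -- the coordinate functional is proportional to `a0`
  have hpr : ∀ j k, (b j).repr p k = 0 → ∃ l : ℚ, l ≠ 0 ∧ ∀ q, (b j).repr q k = l * a0 q := by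
    intro j k h
    obtain ⟨l, hl, he⟩ := hprop _ (hcoord j k) h
    exact ⟨l, hl, fun q => by simpa using congrArg (fun f => f q) he⟩
  have hH : ∀ (j : {j // S j}) (q : V), q ∈ H ↔ (b j).repr q (kk j) = 0 := by
    intro j q
    obtain ⟨l, hl, he⟩ := hpr j _ (hkk j)
    rw [he]
    simp [H, hl]
  choose b' hb' hr using fun j : {j // S j} => facet_basis (b j) (kk j) H (hH j)
  have hηk : ∀ j : {j // S j}, (b j).repr η (kk j) ≠ 0 := by
    intro j
    obtain ⟨l, hl, he⟩ := hpr j _ (hkk j)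
    rw [he]; exact mul_ne_zero hl hη
  -- other coordinates of the `S` family are not vanishing at `p`
  have hS1 : ∀ j : {j // S j}, ∀ i, (b j).repr p ((kk j).succAbove i) ≠ 0 := by
    intro j i h0
    obtain ⟨l, hl, he⟩ := hpr j _ (hkk j)
    obtain ⟨l', hl', he'⟩ := hpr j _ h0
    have e1 := he (b j (kk j))
    have e2 := he' (b j (kk j))
    rw [Module.Basis.repr_self] at e1 e2
    simp at e1 e2
    rcases e2 with e2 | e2
    · exact hl' e2
    · simp [e2] at e1
  have hS2 : ∀ j, ¬ S j → ∀ k, (b j).repr p k ≠ 0 := fun j hj k h0 => hj ((hS j).2 ⟨k, h0⟩)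
  rw [← sub_eq_zero]
  have key := family_jump c b y H S kk b' hb' hr ⟨p, hpH⟩ η s t hs ht hkk hηk
    (fun j k h => hss _ (hcoord j k) h) hS1 hS2
  simp only at key
  rw [key]
  -- apply the induction hypothesis
  refine hZ H {j // S j} _ b' _
    ((A.image fun a => (a ∘ₗ H.subtype : Module.Dual ℚ H)).filter fun a => a ≠ 0) ?_ ?_ ⟨p, hpH⟩ ?_
  · intro a ha
    exact (Finset.mem_filter.1 ha).2
  · intro q hq
    obtain ⟨ε, hε, hsm⟩ := exists_small A (q : V) η
    have hz : ∀ a ∈ A, a (q : V) = 0 → ∃ l : ℚ, l ≠ 0 ∧ a = l • a0 := by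
      intro a ha h0
      apply hprop a ha
      by_contra h1
      have : (a ∘ₗ H.subtype : Module.Dual ℚ H) ≠ 0 := fun h2 => h1 (by
        simpa using congrArg (fun f => f ⟨p, hpH⟩) h2)
      exact hq _ (Finset.mem_filter.2 ⟨Finset.mem_image_of_mem _ ha, this⟩) (by simpa using h0)
    have hnz : ∀ a ∈ A, a p ≠ 0 → a (q : V) ≠ 0 := by
      intro a ha h1 h0
      obtain ⟨l, hl, he⟩ := hz a ha h0
      apply h1
      rw [he]; simp [hp0]
    have hq0 : a0 (q : V) = 0 := q.2
    have hgen : ∀ a ∈ A, a ((q : V) + ε • η) ≠ 0 ∧ a ((q : V) - ε • η) ≠ 0 := by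
      intro a ha
      by_cases h0 : a (q : V) = 0
      · obtain ⟨l, hl, he⟩ := hz a ha h0
        simp [he, hq0, hl, hη, hε.ne']
      · exact ⟨(hsm a ha h0).1.ne h0, (hsm a ha h0).2.ne h0⟩
    have key2 := family_jump c b 0 H S kk b' hb' hr q η ε ε hε hε (fun j => (hH j _).1 q.2) hηk
      (fun j k h => hsm _ (hcoord j k) h) (fun j i => hnz _ (hcoord _ _) (hS1 j i))
      (fun j hj k => hnz _ (hcoord _ _) (hS2 j hj k))
    rw [hvan _ fun a ha => (hgen a ha).1, hvan _ fun a ha => (hgen a ha).2, sub_zero] at key2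
    rw [LinearMap.zero_comp] at key2
    exact key2.symm
  · intro j i
    rw [hr]
    exact hS1 j i

lemma line_walk (B : Finset ℚ) (f : ℚ → ℤ)
    (h0 : ∀ s, (∀ t ∈ B, t < s) → f s = 0)
    (h1 : ∀ s s' t, s < t → t < s' → t ∈ B → (∀ t' ∈ B, s ≤ t' → t' ≤ s' → t' = t) → f s = f s') :
    ∀ s, s ∉ B → f s = 0 := by
  suffices ∀ N s, s ∉ B → (B.filter (s < ·)).card = N → f s = 0 from fun s hs => this _ s hs rfl
  intro N
  induction N using Nat.strong_induction_on with
  | _ N ih =>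
  intro s hs hN
  by_cases hE : (B.filter (s < ·)).Nonempty
  · obtain ⟨t, ht, hmin⟩ := (B.filter (s < ·)).exists_min_image id hE
    rw [Finset.mem_filter] at ht
    have hev : ∀ t' ∈ B, ∀ᶠ m : ℚ in nhdsWithin t (Set.Ioi t), t < t' → m < t' := by
      intro t' _
      by_cases h : t < t'
      · filter_upwards [eventually_nhdsWithin_of_eventually_nhds (eventually_lt_nhds h)] with m hm _
        exact hm
      · simp [h]
    obtain ⟨m, hm1, hm2⟩ := (((Filter.eventually_all_finset B).2 hev).and
      self_mem_nhdsWithin).exists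
    have hm2 : t < m := hm2
    have hmB : m ∉ B := fun h => lt_irrefl _ (hm1 m h hm2)
    rw [h1 s m t ht.2 hm2 ht.1]
    · refine ih _ ?_ m hmB rfl
      rw [← hN]
      apply Finset.card_lt_card
      rw [Finset.ssubset_iff_of_subset]
      · exact ⟨t, Finset.mem_filter.2 ht, by simp [hm2.le]⟩
      · intro z hz
        rw [Finset.mem_filter] at hz ⊢
        exact ⟨hz.1, by linarith [ht.2]⟩
    · intro t' ht' h2 h3
      have h4 : s < t' := lt_of_le_of_ne h2 (fun h => hs (h ▸ ht'))
      have h5 : t ≤ t' := hmin t' (Finset.mem_filter.2 ⟨ht', h4⟩)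
      by_contra h6
      have := hm1 t' ht' (lt_of_le_of_ne h5 (Ne.symm h6))
      linarith
  · rw [Finset.not_nonempty_iff_eq_empty, Finset.filter_eq_empty_iff] at hE
    apply h0
    intro t ht
    exact lt_of_le_of_ne (not_lt.1 (hE ht)) (fun h => hs (h ▸ ht))

/-- An affine function of one variable without zeros on an interval has constant sign. -/
lemma sameSign_affine {x e s s' : ℚ} (h : ∀ t, s ≤ t → t ≤ s' → x + t * e ≠ 0) {r r' : ℚ}
    (h1 : s ≤ r) (h2 : r ≤ s') (h3 : s ≤ r') (h4 : r' ≤ s') :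
    SameSign (x + r * e) (x + r' * e) := by
  have key : ∀ r r', s ≤ r → r ≤ s' → s ≤ r' → r' ≤ s' → 0 < x + r * e → 0 < x + r' * e := by
    intro r r' h1 h2 h3 h4 h5
    by_contra h6
    have he : e ≠ 0 := by rintro rfl; simp at h5 h6; linarith
    have hz : x + (-x / e) * e = 0 := by field_simp; ring
    refine h (-x / e) ?_ ?_ hz
    · by_contra! h7
      rcases lt_or_gt_of_ne he with h8 | h8 <;> nlinarith
    · by_contra! h7
      rcases lt_or_gt_of_ne he with h8 | h8 <;> nlinarith
  have k1 := key r r' h1 h2 h3 h4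
  have k2 := key r' r h3 h4 h1 h2
  have n1 := h r h1 h2
  have n2 := h r' h3 h4
  refine ⟨⟨k1, k2⟩, fun h => ?_, fun h => ?_⟩
  · by_contra h'
    exact absurd (k2 (lt_of_le_of_ne (not_lt.1 h') n2.symm)) (by linarith)
  · by_contra h'
    exact absurd (k1 (lt_of_le_of_ne (not_lt.1 h') n1.symm)) (by linarith)

lemma ZStmt_succ {n : ℕ} (hZ : ZStmt n) : ZStmt (n+1) := by
  intro V _ _ J _ c b y A₀ hA₀ hvan₀ ξ₀ hξ₀
  -- enlarge `A₀` by the coordinate functionals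
  obtain ⟨A, hAdef⟩ : ∃ A : Finset (Module.Dual ℚ V),
      A = A₀ ∪ Finset.univ.image (fun jk : J × Fin (n+1) => (b jk.1).coord jk.2) := ⟨_, rfl⟩
  have hcoord : ∀ j k, (b j).coord k ∈ A := by
    intro j k
    rw [hAdef]
    exact Finset.mem_union_right _ (Finset.mem_image.2 ⟨(j, k), Finset.mem_univ _, rfl⟩)
  have hA : ∀ a ∈ A, a ≠ 0 := by
    intro a ha
    rw [hAdef, Finset.mem_union] at ha
    rcases ha with ha | ha
    · exact hA₀ a ha
    · obtain ⟨jk, _, rfl⟩ := Finset.mem_image.1 ha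
      intro h
      have := congrArg (fun f => f (b jk.1 jk.2)) h
      simp at this
  have hvan : ∀ q, (∀ a ∈ A, a q ≠ 0) → ∑ j, c j * sgf (b j) 0 q = 0 := fun q hq =>
    hvan₀ q fun a ha => hq a (by rw [hAdef]; exact Finset.mem_union_left _ ha)
  -- perturb `ξ₀`
  obtain ⟨u, hu⟩ := exists_avoid A hA
  obtain ⟨ε, hε, hsm⟩ : ∃ ε : ℚ, 0 < ε ∧ ∀ a ∈ A, (a ξ₀ ≠ 0 →
      SameSign (a (ξ₀ + ε • u)) (a ξ₀) ∧ SameSign (a (ξ₀ - ε • u)) (a ξ₀)) := exists_small A ξ₀ u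
  obtain ⟨ξ, hξA, hξξ⟩ : ∃ ξ, (∀ a ∈ A, a ξ ≠ 0) ∧
      ∑ j, c j * sgf (b j) y ξ₀ = ∑ j, c j * sgf (b j) y ξ := by
    refine ⟨ξ₀ + ε • u, ?_, ?_⟩
    · intro a ha
      by_cases h : a ξ₀ = 0
      · simp [h, hε.ne', hu a ha]
      · exact (hsm a ha h).1.ne h
    · refine Finset.sum_congr rfl fun j _ => ?_
      rw [sgf_congr (b j) y (ξ₀ + ε • u) ξ₀ fun k => (hsm _ (hcoord j k) (hξ₀ j k)).1]
  rw [hξξ]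
  by_cases hy : y = 0
  · rw [hy]; exact hvan ξ hξA
  -- choose a generic direction
  obtain ⟨η, hyη, hη⟩ : ∃ η : V, y η < 0 ∧
      ∀ a ∈ A, ∀ a' ∈ A, (a' ξ • a - a ξ • a') η = 0 → a' ξ • a = a ξ • a' := by
    obtain ⟨u, hu⟩ := exists_avoid (insert y (((A ×ˢ A).image
      fun x => x.2 ξ • x.1 - x.1 ξ • x.2).filter fun a => a ≠ 0)) (by
        intro a ha
        rcases Finset.mem_insert.1 ha with rfl | ha
        · exact hy
        · exact (Finset.mem_filter.1 ha).2)
    have hu2 : ∀ a ∈ A, ∀ a' ∈ A, (a' ξ • a - a ξ • a') u = 0 → a' ξ • a = a ξ • a' := by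
      intro a ha a' ha' h
      by_contra hne
      refine hu _ (Finset.mem_insert_of_mem (Finset.mem_filter.2
        ⟨Finset.mem_image.2 ⟨(a, a'), Finset.mem_product.2 ⟨ha, ha'⟩, rfl⟩, ?_⟩)) h
      exact sub_ne_zero.2 hne
    rcases lt_or_gt_of_ne (hu y (Finset.mem_insert_self _ _)) with h | h
    · exact ⟨u, h, hu2⟩
    · refine ⟨-u, by simpa using h, fun a ha a' ha' h => hu2 a ha a' ha' ?_⟩
      rw [map_neg, neg_eq_zero] at h
      exact h
  -- the bad times
  obtain ⟨B, hB⟩ : ∃ B : Finset ℚ, ∀ t, t ∈ B ↔ ∃ a ∈ A, a ξ + t * a η = 0 := by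
    refine ⟨(A.image fun a => -a ξ / a η).filter fun t => ∃ a ∈ A, a ξ + t * a η = 0, ?_⟩
    intro t
    rw [Finset.mem_filter, and_iff_right_iff_imp]
    rintro ⟨a, ha, h⟩
    refine Finset.mem_image.2 ⟨a, ha, ?_⟩
    have : a η ≠ 0 := by
      intro h0
      rw [h0] at h
      exact hξA a ha (by simpa using h)
    field_simp
    linarith
  have hlin : ∀ (a : Module.Dual ℚ V) (t : ℚ), a (ξ + t • η) = a ξ + t * a η := by
    intro a t; simp
  have main := line_walk B (fun t => ∑ j, c j * sgf (b j) y (ξ + t • η)) ?_ ?_ 0 ?_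
  · simpa using main
  · intro s hs
    -- far away
    let s' := max s (1 + y ξ / (-(y η)))
    have hs' : y (ξ + s' • η) < 0 := by
      have : 1 + y ξ / (-(y η)) ≤ s' := le_max_right _ _
      have h2 : y ξ / (-(y η)) < s' := by linarith
      rw [div_lt_iff₀ (by linarith)] at h2
      rw [hlin]; linarith
    have : ∀ j, sgf (b j) y (ξ + s • η) = 0 := by
      intro j
      rw [← sgf_eq_zero (b j) y _ hs']
      apply sgf_congr
      intro k
      have := sameSign_affine (x := (b j).coord k ξ) (e := (b j).coord k η) (s := s) (s' := s')
        (r := s) (r' := s') (fun t h1 h2 h3 => ?_) le_rfl (le_max_left _ _) (le_max_left _ _) le_rfl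
      · simpa using this
      · have := hs t ((hB t).2 ⟨_, hcoord j k, h3⟩)
        linarith
    simp [this]
  · intro s s' t hst hts' htB huniq
    obtain ⟨a0, ha0, hz0⟩ := (hB t).1 htB
    have haη : ∀ a ∈ A, a ξ + t * a η = 0 → a η ≠ 0 := by
      intro a ha h h0
      rw [h0] at h
      exact hξA a ha (by simpa using h)
    have key := cross hZ c b y A hcoord hvan (ξ + t • η) η (t - s) (s' - t) (by linarith)
      (by linarith) a0 (by rw [hlin]; exact hz0) ?_ (haη a0 ha0 hz0) ?_
    · have e1 : ξ + t • η + (s' - t) • η = ξ + s' • η := by module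
      have e2 : ξ + t • η - (t - s) • η = ξ + s • η := by module
      rw [e1, e2] at key
      exact key.symm
    · intro a ha haz
      rw [hlin] at haz
      have h := hη a ha a0 ha0 (by
        have ht0 : t ≠ 0 := by
          rintro rfl
          exact hξA a ha (by simpa using haz)
        have : t * (a0 ξ * a η - a ξ * a0 η) = 0 := by linear_combination a0 ξ * haz - a ξ * hz0
        simpa [ht0] using this)
      have h1 := hξA a0 ha0
      refine ⟨a ξ / a0 ξ, div_ne_zero (hξA a ha) h1, ?_⟩
      rw [div_eq_inv_mul, mul_smul, ← h, smul_smul, inv_mul_cancel₀ h1, one_smul]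
    · intro a ha hne
      rw [hlin] at hne
      have hno : ∀ t', s ≤ t' → t' ≤ s' → a ξ + t' * a η ≠ 0 := by
        intro t' h1 h2 h3
        have := huniq t' ((hB t').2 ⟨a, ha, h3⟩) h1 h2
        rw [this] at h3
        exact hne h3
      have e1 : ξ + t • η + (s' - t) • η = ξ + s' • η := by module
      have e2 : ξ + t • η - (t - s) • η = ξ + s • η := by module
      rw [e1, e2, hlin, hlin, hlin]
      exact ⟨sameSign_affine hno (by linarith) le_rfl hst.le hts'.le,
        sameSign_affine hno le_rfl (by linarith) hst.le hts'.le⟩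
  · intro h
    obtain ⟨a, ha, h⟩ := (hB 0).1 h
    exact hξA a ha (by simpa using h)

theorem ZStmt_all (n : ℕ) : ZStmt n := by
  induction n with
  | zero => exact ZStmt_zero
  | succ n ih => exact ZStmt_succ ih

lemma farkas {W ι : Type} [AddCommGroup W] [Module ℚ W] (s : Finset ι) :
    ∀ (a : ι → Module.Dual ℚ W) (b : Module.Dual ℚ W),
      (∀ x, (∀ i ∈ s, 0 ≤ a i x) → 0 ≤ b x) →
      ∃ l : ι → ℚ, (∀ i ∈ s, 0 ≤ l i) ∧ b = ∑ i ∈ s, l i • a i := by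
  induction s using Finset.induction_on with
  | empty =>
    intro a b h
    refine ⟨0, by simp, ?_⟩
    ext x
    have h1 := h x (by simp)
    have h2 := h (-x) (by simp)
    simp at h2
    simpa using le_antisymm h2 h1
  | insert m s hm ih =>
    intro a b h
    by_cases hc : ∀ x, (∀ i ∈ s, 0 ≤ a i x) → 0 ≤ b x
    · obtain ⟨l, hl, he⟩ := ih a b hc
      refine ⟨Function.update l m 0, ?_, ?_⟩
      · intro i hi
        by_cases him : i = m
        · simp [him]
        · simp [him, hl i (Finset.mem_of_mem_insert_of_ne hi him)]
      · rw [Finset.sum_insert hm, he]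
        simp only [Function.update_self, zero_smul, zero_add]
        refine Finset.sum_congr rfl fun i hi => ?_
        rw [Function.update_of_ne (ne_of_mem_of_not_mem hi hm)]
    · push Not at hc
      obtain ⟨z, hz, hbz⟩ := hc
      have hmz : a m z < 0 := by
        by_contra h0
        refine absurd (h z ?_) (not_le.2 hbz)
        intro i hi
        rcases Finset.mem_insert.1 hi with rfl | hi
        · linarith
        · exact hz i hi
      obtain ⟨l, hl, he⟩ := ih (fun i => a i - (a i z / a m z) • a m) (b - (b z / a m z) • a m) (by
        intro x hx
        have := h (x - (a m x / a m z) • z) (by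
          intro i hi
          rcases Finset.mem_insert.1 hi with rfl | hi
          · simp [hmz.ne]
          · have := hx i hi
            simp at this ⊢
            convert this using 1
            ring)
        simp at this ⊢
        convert this using 1
        ring)
      refine ⟨Function.update l m (b z / a m z - ∑ i ∈ s, l i * (a i z / a m z)), ?_, ?_⟩
      · intro i hi
        by_cases him : i = m
        · rw [him, Function.update_self]
          have h1 : 0 ≤ b z / a m z := div_nonneg_of_nonpos hbz.le hmz.le
          have h2 : ∑ i ∈ s, l i * (a i z / a m z) ≤ 0 := Finset.sum_nonpos fun i hi =>
            mul_nonpos_of_nonneg_of_nonpos (hl i hi)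
              (div_nonpos_of_nonneg_of_nonpos (hz i hi) hmz.le)
          linarith
        · rw [Function.update_of_ne him]
          exact hl i (Finset.mem_of_mem_insert_of_ne hi him)
      · rw [Finset.sum_insert hm, Function.update_self]
        have h1 : ∑ i ∈ s, Function.update l m (b z / a m z - ∑ i ∈ s, l i * (a i z / a m z)) i • a i
            = ∑ i ∈ s, l i • a i := Finset.sum_congr rfl fun i hi => by
          rw [Function.update_of_ne (ne_of_mem_of_not_mem hi hm)]
        rw [h1]
        clear h1 h hbz
        generalize b z / a m z = β at he ⊢
        rw [sub_eq_iff_eq_add] at he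
        rw [he]
        simp only [smul_sub, Finset.sum_sub_distrib, sub_smul, smul_smul, Finset.sum_smul]
        abel

lemma separation {d : ℕ} (T : Finset (Fin d → ℚ)) (x : Fin d → ℚ)
    (hx : x ∉ convexHull ℚ (T : Set (Fin d → ℚ))) :
    ∃ (η : Module.Dual ℚ (Fin d → ℚ)) (s : ℚ),
      (∀ v ∈ convexHull ℚ (T : Set (Fin d → ℚ)), 0 < s + η v) ∧ s + η x < 0 := by
  let a : (Fin d → ℚ) → Module.Dual ℚ (Module.Dual ℚ (Fin d → ℚ) × ℚ) := fun v =>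
    (Module.Dual.eval ℚ (Fin d → ℚ) v).coprod LinearMap.id
  have ha : ∀ v η s, a v (η, s) = η v + s := by intro v η s; simp [a]
  by_cases h : ∀ z, (∀ v ∈ T, 0 ≤ a v z) → 0 ≤ a x z
  · exfalso
    obtain ⟨l, hl, he⟩ := farkas T a (a x) h
    apply hx
    rw [Finset.mem_convexHull']
    have hev : ∀ (η : Module.Dual ℚ (Fin d → ℚ)) (s : ℚ), η x + s = ∑ v ∈ T, l v * (η v + s) := by
      intro η s
      have := congrArg (fun f => f (η, s)) he
      simpa [ha] using this
    refine ⟨l, hl, ?_, ?_⟩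
    · simpa using (hev 0 1).symm
    · ext i
      have := hev (LinearMap.proj i) 0
      simpa using this.symm
  · push Not at h
    obtain ⟨⟨η, s⟩, h1, h2⟩ := h
    simp only [ha] at h1 h2
    refine ⟨η, s - (η x + s) / 2, ?_, by linarith⟩
    intro v hv
    rw [Finset.mem_convexHull'] at hv
    obtain ⟨w, hw, hw1, rfl⟩ := hv
    have : 0 ≤ ∑ v ∈ T, w v * (η v + s) :=
      Finset.sum_nonneg fun v hv => mul_nonneg (hw v hv) (h1 v hv)
    simp only [mul_add, Finset.sum_add_distrib, ← Finset.sum_mul, hw1] at this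
    simp only [map_sum, map_smul, smul_eq_mul]
    linarith

lemma IsVertex.mem {d : ℕ} {P : Set (Fin d → ℚ)} {v : Fin d → ℚ} (h : IsVertex P v) : v ∈ P := by
  obtain ⟨l, hl⟩ := h
  have : v ∈ ({v} : Set (Fin d → ℚ)) := rfl
  rw [hl] at this
  exact this.1

lemma IsVertex.mem_finset {d : ℕ} {T : Finset (Fin d → ℚ)} {v : Fin d → ℚ}
    (h : IsVertex (convexHull ℚ (T : Set (Fin d → ℚ))) v) : v ∈ T := by
  have hvP := h.mem
  obtain ⟨l, hl⟩ := h
  by_contra hvT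
  have hmax : ∀ y ∈ convexHull ℚ (T : Set (Fin d → ℚ)), l y ≤ l v := by
    have : v ∈ ({v} : Set (Fin d → ℚ)) := rfl
    rw [hl] at this
    exact this.2
  have hlt : ∀ y ∈ T, l y < l v := by
    intro y hy
    have hyP := subset_convexHull ℚ (T : Set (Fin d → ℚ)) hy
    refine lt_of_le_of_ne (hmax y hyP) fun he => ?_
    have : y ∈ ({v} : Set (Fin d → ℚ)) := by
      rw [hl]
      exact ⟨hyP, fun z hz => he ▸ hmax z hz⟩
    exact hvT (this ▸ hy)
  rw [Finset.mem_convexHull'] at hvP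
  obtain ⟨w, hw, hw1, he⟩ := hvP
  have h1 : l v = ∑ y ∈ T, w y * l y := by
    conv_lhs => rw [← he]
    simp
  have h2 : ∑ y ∈ T, w y * (l v - l y) = 0 := by
    simp only [mul_sub, Finset.sum_sub_distrib, ← Finset.sum_mul, hw1]
    linarith
  rw [Finset.sum_eq_zero_iff_of_nonneg
    (fun y hy => mul_nonneg (hw y hy) (sub_nonneg.2 (hlt y hy).le))] at h2
  have h3 : ∑ y ∈ T, w y = 0 := Finset.sum_eq_zero fun y hy => by
    rcases mul_eq_zero.1 (h2 y hy) with h | h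
    · exact h
    · linarith [hlt y hy]
  linarith

lemma exists_vertex {d : ℕ} {T : Finset (Fin d → ℚ)} (hT : T.Nonempty)
    (q : Module.Dual ℚ (Fin d → ℚ)) :
    ∃ v, IsVertex (convexHull ℚ (T : Set (Fin d → ℚ))) v ∧
      q ∈ normalCone (convexHull ℚ (T : Set (Fin d → ℚ))) v := by
  obtain ⟨u, hu⟩ := exists_avoid (V := Module.Dual ℚ (Fin d → ℚ))
    (((T ×ˢ T).image fun x => Module.Dual.eval ℚ (Fin d → ℚ) (x.1 - x.2)).filter fun a => a ≠ 0)
    (fun a ha => (Finset.mem_filter.1 ha).2)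
  have hu : ∀ v ∈ T, ∀ v' ∈ T, v ≠ v' → u v ≠ u v' := by
    intro v hv v' hv' hne he
    refine hu (Module.Dual.eval ℚ (Fin d → ℚ) (v - v')) (Finset.mem_filter.2
        ⟨Finset.mem_image.2 ⟨(v, v'), Finset.mem_product.2 ⟨hv, hv'⟩, rfl⟩, ?_⟩) (by simp [he])
    intro h0
    apply hne
    ext i
    have := congrArg (fun f => f (LinearMap.proj i)) h0
    simp at this
    linarith
  obtain ⟨v₀, hv₀, hmin₀⟩ := T.exists_min_image q hT
  obtain ⟨v, hv, hmin⟩ := (T.filter fun v => q v = q v₀).exists_min_image u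
    ⟨v₀, Finset.mem_filter.2 ⟨hv₀, rfl⟩⟩
  rw [Finset.mem_filter] at hv
  obtain ⟨hvT, hqv⟩ := hv
  have hev : ∀ v' ∈ T, ∀ᶠ ε : ℚ in nhdsWithin 0 (Set.Ioi 0),
      v' ≠ v → q v + ε * u v < q v' + ε * u v' := by
    intro v' hv'
    by_cases hne : v' = v
    · simp [hne]
    rcases lt_or_eq_of_le (hmin₀ v' hv') with h | h
    · have c1 : Filter.Tendsto (fun ε : ℚ => q v + ε * u v) (nhds 0) (nhds (q v)) := by
        have : Continuous (fun ε : ℚ => q v + ε * u v) := by fun_prop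
        simpa using this.tendsto 0
      have c2 : Filter.Tendsto (fun ε : ℚ => q v' + ε * u v') (nhds 0) (nhds (q v')) := by
        have : Continuous (fun ε : ℚ => q v' + ε * u v') := by fun_prop
        simpa using this.tendsto 0
      filter_upwards [eventually_nhdsWithin_of_eventually_nhds
        (c1.eventually_lt c2 (hqv ▸ h))] with ε hε _
      exact hε
    · filter_upwards [self_mem_nhdsWithin] with ε hε _
      have hε : 0 < ε := hε
      have h1 := hmin v' (Finset.mem_filter.2 ⟨hv', h.symm⟩)
      have h2 := lt_of_le_of_ne h1 (hu v hvT v' hv' (Ne.symm hne))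
      have := mul_lt_mul_of_pos_left h2 hε
      linarith
  obtain ⟨ε, hε⟩ := ((Filter.eventually_all_finset T).2 hev).exists
  refine ⟨v, ⟨-(q + ε • u), ?_⟩, ?_⟩
  · have hle : ∀ y ∈ convexHull ℚ (T : Set (Fin d → ℚ)),
        (q + ε • u) v ≤ (q + ε • u) y ∧ ((q + ε • u) y ≤ (q + ε • u) v → y = v) := by
      intro y hy
      rw [Finset.mem_convexHull'] at hy
      obtain ⟨w, hw, hw1, rfl⟩ := hy
      have hnn : ∀ y ∈ T, 0 ≤ w y * ((q + ε • u) y - (q + ε • u) v) := by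
        intro y hy
        apply mul_nonneg (hw y hy)
        by_cases h : y = v
        · simp [h]
        · have := hε y hy h
          simp; linarith
      have hs : (q + ε • u) (∑ y ∈ T, w y • y) - (q + ε • u) v =
          ∑ y ∈ T, w y * ((q + ε • u) y - (q + ε • u) v) := by
        simp only [mul_sub, Finset.sum_sub_distrib, ← Finset.sum_mul, hw1, one_mul, map_sum,
          map_smul, smul_eq_mul]
      have h0 := Finset.sum_nonneg hnn
      refine ⟨by linarith, fun hle => ?_⟩
      have hz : ∑ y ∈ T, w y * ((q + ε • u) y - (q + ε • u) v) = 0 := by linarith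
      rw [Finset.sum_eq_zero_iff_of_nonneg hnn] at hz
      have : ∀ y ∈ T, w y • y = w y • v := by
        intro y hy
        by_cases h : y = v
        · rw [h]
        · rcases mul_eq_zero.1 (hz y hy) with h' | h'
          · simp [h']
          · have := hε y hy h
            simp at h'
            linarith
      rw [Finset.sum_congr rfl this, ← Finset.sum_smul, hw1, one_smul]
    have hvP := subset_convexHull ℚ (T : Set (Fin d → ℚ)) hvT
    ext y
    simp only [Set.mem_singleton_iff, Set.mem_ofPred_eq]
    constructor
    · rintro rfl
      exact ⟨hvP, fun z hz => by
        have := (hle z hz).1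
        simp only [LinearMap.neg_apply]; linarith⟩
    · rintro ⟨hy, hy2⟩
      apply (hle y hy).2
      have := hy2 v hvP
      simp only [LinearMap.neg_apply] at this; linarith
  · intro y hy
    rw [Finset.mem_convexHull'] at hy
    obtain ⟨w, hw, hw1, rfl⟩ := hy
    have h1 : ∑ y ∈ T, w y * q v ≤ ∑ y ∈ T, w y * q y :=
      Finset.sum_le_sum fun y hy => mul_le_mul_of_nonneg_left (hqv ▸ hmin₀ y hy) (hw y hy)
    rw [← Finset.sum_mul, hw1, one_mul] at h1
    simpa using h1

lemma sgf_zero_label {n : ℕ} {V : Type} [AddCommGroup V] [Module ℚ V]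
    (b : Module.Basis (Fin n) ℚ V) (q : V) :
    sgf b 0 q = if ∀ k, 0 < b.repr q k then 1 else 0 := by
  unfold sgf phi
  simp [Finset.prod_boole]

/-- Lifting a basis of `D` to a basis of `D × ℚ`. -/
lemma lift_basis {d : ℕ} {D : Type} [AddCommGroup D] [Module ℚ D]
    (b : Module.Basis (Fin d) ℚ D) (v : D →ₗ[ℚ] ℚ) (η : D) (s0 : ℚ) (h : s0 + v η ≠ 0) :
    ∃ b' : Module.Basis (Fin (d+1)) ℚ (D × ℚ),
      b' 0 = (η, s0) ∧ (∀ k : Fin d, b' k.succ = (b k, -v (b k))) ∧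
      (∀ q s, b'.repr (q, s) 0 = (s + v q) / (s0 + v η)) ∧
      (∀ q s (k : Fin d), b'.repr (q, s) k.succ = b.repr (q - ((s + v q) / (s0 + v η)) • η) k) := by
  let e : (D × ℚ) ≃ₗ[ℚ] (Fin (d+1) → ℚ) :=
    { toFun := fun z => Fin.cons ((z.2 + v z.1) / (s0 + v η))
        (fun k => b.repr (z.1 - ((z.2 + v z.1) / (s0 + v η)) • η) k)
      map_add' := by
        intro x y
        ext k
        refine Fin.cases ?_ (fun k => ?_) k
        · simp; ring
        · simp; ring
      map_smul' := by
        intro x y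
        ext k
        refine Fin.cases ?_ (fun k => ?_) k
        · simp; ring
        · simp; ring
      invFun := fun c => ((∑ k : Fin d, c k.succ • b k) + c 0 • η,
        - v (∑ k : Fin d, c k.succ • b k) + c 0 * s0)
      left_inv := by
        rintro ⟨q, s⟩
        have h1 := b.sum_repr (q - ((s + v q) / (s0 + v η)) • η)
        simp only [Fin.cons_zero, Fin.cons_succ]
        rw [h1]
        refine Prod.ext (by simp) ?_
        simp only [map_sub, map_smul, smul_eq_mul]
        field_simp
        ring
      right_inv := by
        intro c
        have hn : ∀ n : D, ((-v n + c 0 * s0) + v (n + c 0 • η)) / (s0 + v η) = c 0 := by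
          intro n
          simp only [map_add, map_smul, smul_eq_mul]
          field_simp
          ring
        ext k
        refine Fin.cases ?_ (fun k => ?_) k
        · simp only [Fin.cons_zero]
          exact hn _
        · simp only [Fin.cons_succ, hn, add_sub_cancel_right]
          rw [Module.Basis.repr_sum_self] }
  refine ⟨Module.Basis.ofEquivFun e, ?_, ?_, ?_, ?_⟩
  · simp [e]
  · intro k
    simp [e, Pi.single_apply]
  · intro q s
    simp [e]
  · intro q s k
    simp [e]

/-- Data extracted from the triangulations of the normal cones. -/
structure FanData (d : ℕ) (P : Set (Fin d → ℚ)) (J : Type) where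
  v : J → (Fin d → ℚ)
  b : J → Module.Basis (Fin d) ℚ (Module.Dual ℚ (Fin d → ℚ))
  vP : ∀ j, v j ∈ P
  sub : ∀ j q, (∀ k, 0 ≤ (b j).repr q k) → q ∈ normalCone P (v j)
  cov : ∀ v0 q, IsVertex P v0 → q ∈ normalCone P v0 → ∃ j, v j = v0 ∧ ∀ k, 0 ≤ (b j).repr q k
  uniq : ∀ j j' q, (∀ k, 0 < (b j).repr q k) → (∀ k, 0 < (b j').repr q k) → j = j'

lemma count {d : ℕ} {T : Finset (Fin d → ℚ)} (hT : T.Nonempty) {J : Type} [Fintype J]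
    (F : FanData d (convexHull ℚ (T : Set (Fin d → ℚ))) J)
    (η : Module.Dual ℚ (Fin d → ℚ)) (s0 : ℚ)
    (hpos : ∀ v ∈ convexHull ℚ (T : Set (Fin d → ℚ)), 0 < s0 + η v)
    (B : J → Module.Basis (Fin (d+1)) ℚ (Module.Dual ℚ (Fin d → ℚ) × ℚ))
    (hB0 : ∀ j q s, (B j).repr (q, s) 0 = (s + q (F.v j)) / (s0 + η (F.v j)))
    (hB1 : ∀ j q s (k : Fin d), (B j).repr (q, s) k.succ =
      (F.b j).repr (q - ((s + q (F.v j)) / (s0 + η (F.v j))) • η) k)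
    (q : Module.Dual ℚ (Fin d → ℚ)) (s : ℚ) (hgen : ∀ j k, (B j).repr (q, s) k ≠ 0) :
    ∑ j, sgf (B j) 0 (q, s) =
      if ∀ v ∈ convexHull ℚ (T : Set (Fin d → ℚ)), 0 < s + q v then 1 else 0 := by
  obtain ⟨P, hP⟩ : ∃ P, P = convexHull ℚ (T : Set (Fin d → ℚ)) := ⟨_, rfl⟩
  have hiff : ∀ j, (∀ k, 0 < (B j).repr (q, s) k) ↔ 0 < (s + q (F.v j)) / (s0 + η (F.v j)) ∧
      ∀ k, 0 < (F.b j).repr (q - ((s + q (F.v j)) / (s0 + η (F.v j))) • η) k := by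
    intro j
    rw [Fin.forall_fin_succ, hB0]
    simp only [hB1]
  -- a cone containing the shifted point realizes the minimal time
  have hmin : ∀ j, (∀ k, 0 ≤ (F.b j).repr (q - ((s + q (F.v j)) / (s0 + η (F.v j))) • η) k) →
      ∀ v ∈ convexHull ℚ (T : Set (Fin d → ℚ)),
        (s + q (F.v j)) / (s0 + η (F.v j)) * (s0 + η v) ≤ s + q v := by
    intro j hj v hv
    have h1 := F.sub j _ hj v hv
    have h2 := hpos _ (F.vP j)
    have h3 : (s + q (F.v j)) / (s0 + η (F.v j)) * (s0 + η (F.v j)) = s + q (F.v j) :=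
      div_mul_cancel₀ _ h2.ne'
    simp only [LinearMap.sub_apply, LinearMap.smul_apply, smul_eq_mul] at h1
    linarith
  simp only [sgf_zero_label]
  split_ifs with hall
  · -- the minimal time
    obtain ⟨v1, hv1, hv1min⟩ := T.exists_min_image (fun v => (s + q v) / (s0 + η v)) hT
    obtain ⟨t, ht⟩ : ∃ t, t = (s + q v1) / (s0 + η v1) := ⟨_, rfl⟩
    obtain ⟨v, hv, hvn⟩ := exists_vertex hT (q - t • η)
    have hmem : ∀ v ∈ T, v ∈ convexHull ℚ (T : Set (Fin d → ℚ)) :=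
      fun v hv => subset_convexHull ℚ (T : Set (Fin d → ℚ)) hv
    have htv : (s + q v) / (s0 + η v) = t := by
      have h1 := hvn v1 (hmem v1 hv1)
      have h2 := hpos v1 (hmem v1 hv1)
      have h3 := hpos v hv.mem
      have h4 : t * (s0 + η v1) = s + q v1 := by rw [ht]; exact div_mul_cancel₀ _ h2.ne'
      apply le_antisymm
      · rw [div_le_iff₀ h3]
        simp only [LinearMap.sub_apply, LinearMap.smul_apply, smul_eq_mul] at h1
        linarith
      · rw [ht]; exact hv1min v hv.mem_finset
    obtain ⟨j, hj, hjk⟩ := F.cov v _ hv hvn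
    have htj : (s + q (F.v j)) / (s0 + η (F.v j)) = t := by rw [hj, htv]
    have hjpos : ∀ k, 0 < (B j).repr (q, s) k := by
      rw [hiff, htj]
      refine ⟨?_, fun k => lt_of_le_of_ne (hjk k) ?_⟩
      · rw [ht]; exact div_pos (hall v1 (hmem _ hv1)) (hpos v1 (hmem _ hv1))
      · have := hgen j k.succ
        rw [hB1, htj] at this
        exact this.symm
    rw [Finset.sum_eq_single j, if_pos hjpos]
    · intro j' _ hne
      rw [if_neg]
      intro hj'
      rw [hiff] at hj' hjpos
      apply hne
      have e1 := hmin j (fun k => (hjpos.2 k).le) _ (F.vP j')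
      have e2 := hmin j' (fun k => (hj'.2 k).le) _ (F.vP j)
      have p1 := hpos _ (F.vP j)
      have p2 := hpos _ (F.vP j')
      rw [← le_div_iff₀ p2] at e1
      rw [← le_div_iff₀ p1] at e2
      have e3 := le_antisymm e1 e2
      rw [e3] at hjpos
      exact F.uniq _ _ _ hj'.2 hjpos.2
    · simp
  · refine Finset.sum_eq_zero fun j _ => if_neg fun hj => hall fun v hv => ?_
    rw [hiff] at hj
    have := hmin j (fun k => (hj.2 k).le) v hv
    have := mul_pos hj.1 (hpos v hv)
    linarith

lemma fan_main {d : ℕ} {T : Finset (Fin d → ℚ)} (hT : T.Nonempty) {J : Type} [Fintype J]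
    (F : FanData d (convexHull ℚ (T : Set (Fin d → ℚ))) J)
    (ξ : Module.Dual ℚ (Fin d → ℚ)) (hξ : ∀ j k, (F.b j).repr ξ k ≠ 0) (x : Fin d → ℚ) :
    ∑ j, sgf (F.b j) (Module.Dual.eval ℚ (Fin d → ℚ) (x - F.v j)) ξ =
      if x ∈ convexHull ℚ (T : Set (Fin d → ℚ)) then 1 else 0 := by
  have hpos1 : ∀ v ∈ convexHull ℚ (T : Set (Fin d → ℚ)),
      0 < (1 : ℚ) + (0 : Module.Dual ℚ (Fin d → ℚ)) v := by simp
  choose B1 hB1a hB1b hB1c hB1d using fun j => lift_basis (F.b j)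
    (Module.Dual.eval ℚ (Fin d → ℚ) (F.v j)) 0 1 (hpos1 _ (F.vP j)).ne'
  simp only [Module.Dual.eval_apply] at hB1a hB1b hB1c hB1d
  have hlarge : ∀ᶠ s : ℚ in Filter.atTop, ∀ v ∈ T, 0 < s + ξ v := by
    rw [Filter.eventually_all_finset]
    intro v _
    filter_upwards [Filter.eventually_gt_atTop (-ξ v)] with s hs
    linarith
  have hull : ∀ s, (∀ v ∈ T, 0 < s + ξ v) →
      ∀ v ∈ convexHull ℚ (T : Set (Fin d → ℚ)), 0 < s + ξ v := by
    intro s hs v hv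
    obtain ⟨w, hw, hw'⟩ := exists_vertex hT ξ
    have := hw' v hv
    have := hs w hw.mem_finset
    linarith
  have hgen1 : ∀ s, (∀ v ∈ convexHull ℚ (T : Set (Fin d → ℚ)), 0 < s + ξ v) →
      ∀ j k, (B1 j).repr (ξ, s) k ≠ 0 := by
    intro s hs j k
    refine Fin.cases ?_ (fun k => ?_) k
    · rw [hB1c]
      simpa using (hs _ (F.vP j)).ne'
    · rw [hB1d]
      simpa using hξ j k
  split_ifs with hx
  · obtain ⟨s, hs⟩ := hlarge.exists
    have hs := hull s hs
    have h := count hT F 0 1 hpos1 B1 hB1c hB1d ξ s (hgen1 s hs)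
    rw [if_pos hs] at h
    rw [← h]
    refine Finset.sum_congr rfl fun j _ => ?_
    unfold sgf
    rw [Fin.prod_univ_succ, hB1c]
    have h0 : phi ((0 : Module.Dual ℚ (Fin d → ℚ) × ℚ →ₗ[ℚ] ℚ) (B1 j 0))
        ((s + ξ (F.v j)) / (1 + (0 : Module.Dual ℚ (Fin d → ℚ)) (F.v j))) = 1 := by
      have := hs _ (F.vP j)
      simp [phi, this]
    rw [h0, one_mul]
    refine Finset.prod_congr rfl fun k _ => ?_
    rw [hB1d]
    have h1 : 0 ≤ (F.b j k) (x - F.v j) := by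
      have := F.sub j (F.b j k) (fun i => by
        rw [Module.Basis.repr_self, Finsupp.single_apply]; split_ifs <;> simp) x hx
      rw [map_sub]; linarith
    rw [map_sub] at h1
    rw [Module.Dual.eval_apply, map_sub]
    simp only [phi, LinearMap.zero_apply, smul_zero, sub_zero,
      le_refl, if_true, if_pos h1]
  · obtain ⟨η, s0, hpos2, hneg⟩ := separation T x hx
    choose B2 hB2a hB2b hB2c hB2d using fun j => lift_basis (F.b j)
      (Module.Dual.eval ℚ (Fin d → ℚ) (F.v j)) η s0 (hpos2 _ (F.vP j)).ne'
    simp only [Module.Dual.eval_apply] at hB2a hB2b hB2c hB2d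
    have hev2 : ∀ᶠ s : ℚ in Filter.atTop, ∀ j k,
        (F.b j).repr (ξ - ((s + ξ (F.v j)) / (s0 + η (F.v j))) • η) k ≠ 0 := by
      rw [Filter.eventually_all]
      intro j
      rw [Filter.eventually_all]
      intro k
      have hp := hpos2 _ (F.vP j)
      by_cases h0 : (F.b j).repr η k = 0
      · refine Filter.Eventually.of_forall fun s => ?_
        simpa [h0] using hξ j k
      · filter_upwards [Filter.eventually_ne_atTop
          ((F.b j).repr ξ k / (F.b j).repr η k * (s0 + η (F.v j)) - ξ (F.v j))] with s hs he
        apply hs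
        simp only [map_sub, map_smul, Finsupp.sub_apply, Finsupp.smul_apply, smul_eq_mul] at he
        field_simp at he ⊢
        linarith
    obtain ⟨s, hs, hs2⟩ := (hlarge.and hev2).exists
    have hs := hull s hs
    have hgen2 : ∀ j k, (B2 j).repr (ξ, s) k ≠ 0 := by
      intro j k
      refine Fin.cases ?_ (fun k => ?_) k
      · rw [hB2c]
        exact (div_pos (hs _ (F.vP j)) (hpos2 _ (F.vP j))).ne'
      · rw [hB2d]
        exact hs2 j k
    let BB : J ⊕ J → Module.Basis (Fin (d+1)) ℚ (Module.Dual ℚ (Fin d → ℚ) × ℚ) := Sum.elim B1 B2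
    let xh : (Module.Dual ℚ (Fin d → ℚ) × ℚ) →ₗ[ℚ] ℚ :=
      (Module.Dual.eval ℚ (Fin d → ℚ) x).coprod LinearMap.id
    have hZ := ZStmt_all (d+1) (Module.Dual ℚ (Fin d → ℚ) × ℚ) (J ⊕ J)
      (Sum.elim (fun _ => 1) (fun _ => -1)) BB xh
      (Finset.univ.image fun jk : (J ⊕ J) × Fin (d+1) => (BB jk.1).coord jk.2) (by
        intro a ha h
        obtain ⟨jk, _, rfl⟩ := Finset.mem_image.1 ha
        have := congrArg (fun f => f (BB jk.1 jk.2)) h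
        simp at this) (by
        rintro ⟨q, s'⟩ hq
        have hq' : ∀ j k, (BB j).repr (q, s') k ≠ 0 := fun j k =>
          hq _ (Finset.mem_image.2 ⟨(j, k), Finset.mem_univ _, rfl⟩)
        have c1 := count hT F 0 1 hpos1 B1 hB1c hB1d q s' (fun j k => hq' (Sum.inl j) k)
        have c2 := count hT F η s0 hpos2 B2 hB2c hB2d q s' (fun j k => hq' (Sum.inr j) k)
        rw [Fintype.sum_sum_type]
        simp only [BB, Sum.elim_inl, Sum.elim_inr, one_mul, neg_one_mul, Finset.sum_neg_distrib]
        rw [c1, c2, add_neg_cancel])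
      (ξ, s) (by
        rintro (j | j) k
        · exact hgen1 s hs j k
        · exact hgen2 j k)
    rw [Fintype.sum_sum_type] at hZ
    simp only [BB, Sum.elim_inl, Sum.elim_inr, one_mul, neg_one_mul, Finset.sum_neg_distrib] at hZ
    have z2 : ∑ j, sgf (B2 j) xh (ξ, s) = 0 := by
      refine Finset.sum_eq_zero fun j _ => ?_
      unfold sgf
      rw [Fin.prod_univ_succ, hB2c, hB2a]
      have h1 : ¬ (0 ≤ xh (η, s0)) := by simp [xh]; linarith
      have h2 := div_pos (hs _ (F.vP j)) (hpos2 _ (F.vP j))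
      have : phi (xh (η, s0)) ((s + ξ (F.v j)) / (s0 + η (F.v j))) = 0 := by
        unfold phi
        rw [if_neg h1, if_neg (not_lt.2 h2.le)]
      rw [this, zero_mul]
    rw [z2, neg_zero, add_zero] at hZ
    rw [← hZ]
    refine Finset.sum_congr rfl fun j _ => ?_
    unfold sgf
    rw [Fin.prod_univ_succ, hB1c, hB1a]
    have h0 : phi (xh (0, 1))
        ((s + ξ (F.v j)) / (1 + (0 : Module.Dual ℚ (Fin d → ℚ)) (F.v j))) = 1 := by
      have := hs _ (F.vP j)
      simp [phi, this, xh]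
    rw [h0, one_mul]
    refine Finset.prod_congr rfl fun k _ => ?_
    rw [hB1d, hB1b]
    simp [xh, sub_eq_add_neg]

/-- The local term is a signed function. -/
lemma term_eq {d : ℕ} (b : Module.Basis (Fin d) ℚ (Module.Dual ℚ (Fin d → ℚ)))
    (w : Fin d → Module.Dual ℚ (Fin d → ℚ)) (hb : ∀ k, b k = w k) (v x : Fin d → ℚ)
    (ξ : Module.Dual ℚ (Fin d → ℚ)) (α : Fin d → ℚ) (hα : ∀ k, b.repr ξ k = α k)
    (hne : ∀ k, α k ≠ 0) :
    (-1 : ℤ) ^ indOf α * indicator (polarCone v w α) x =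
      sgf b (Module.Dual.eval ℚ (Fin d → ℚ) (x - v)) ξ := by
  have h1 : (-1 : ℤ) ^ indOf α = ∏ k, if α k < 0 then (-1 : ℤ) else 1 := by
    rw [Finset.prod_ite]
    simp [indOf]
  have h2 : indicator (polarCone v w α) x =
      ∏ k, if (0 < α k → w k v ≤ w k x) ∧ (α k < 0 → w k x < w k v) then (1 : ℤ) else 0 := by
    rw [Finset.prod_boole]
    have hiff : x ∈ polarCone v w α ↔ ∀ k ∈ Finset.univ,
        (0 < α k → w k v ≤ w k x) ∧ (α k < 0 → w k x < w k v) := by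
      simp [polarCone]
    unfold indicator
    by_cases hx : x ∈ polarCone v w α
    · rw [if_pos hx, if_pos (hiff.1 hx)]
    · rw [if_neg hx, if_neg (fun h => hx (hiff.2 h))]
  rw [h1, h2, ← Finset.prod_mul_distrib]
  unfold sgf
  refine Finset.prod_congr rfl fun k _ => ?_
  rw [hb, hα, Module.Dual.eval_apply, map_sub]
  unfold phi
  rcases lt_or_gt_of_ne (hne k) with h | h
  · by_cases h3 : w k x < w k v
    · have : ¬ (0 ≤ w k x - w k v) := by linarith
      simp [h, h.le, h3]
    · have : 0 ≤ w k x - w k v := by linarith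
      simp [h, h.le, h3, not_lt.1 h3, not_lt.2 h.le]
  · by_cases h3 : w k v ≤ w k x
    · simp [h, h.le, h3]
    · simp [h, h.le, h3]

lemma mem_coneOf_iff {d : ℕ} (b : Module.Basis (Fin d) ℚ (Module.Dual ℚ (Fin d → ℚ)))
    (w : Fin d → Module.Dual ℚ (Fin d → ℚ)) (hb : ∀ k, b k = w k)
    (q : Module.Dual ℚ (Fin d → ℚ)) : q ∈ coneOf w ↔ ∀ k, 0 ≤ b.repr q k := by
  constructor
  · rintro ⟨c, hc, rfl⟩ k
    simp only [← hb]
    rw [Module.Basis.repr_sum_self]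
    exact hc k
  · intro h
    refine ⟨fun k => b.repr q k, h, ?_⟩
    simp only [← hb]
    exact (b.sum_repr q).symm

/-- If a face of a simplicial cone contains an interior point, it is the whole cone. -/
lemma face_full {d : ℕ} (b : Module.Basis (Fin d) ℚ (Module.Dual ℚ (Fin d → ℚ)))
    (w : Fin d → Module.Dual ℚ (Fin d → ℚ)) (hb : ∀ k, b k = w k)
    (q : Module.Dual ℚ (Fin d → ℚ)) (hq : ∀ k, 0 < b.repr q k) (K : Finset (Fin d))
    (h : q ∈ coneFaceOf w K) : coneFaceOf w K = coneOf w := by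
  obtain ⟨c, hc, hK, rfl⟩ := h
  simp only [← hb] at hq
  rw [Module.Basis.repr_sum_self] at hq
  have hKe : ∀ k, k ∉ K := fun k hk => (hq k).ne' (hK k hk)
  ext n
  constructor
  · rintro ⟨c, h1, -, h2⟩
    exact ⟨c, h1, h2⟩
  · rintro ⟨c, h1, h2⟩
    exact ⟨c, h1, fun k hk => absurd hk (hKe k), h2⟩

/-- **Polar decomposition for non-simple polytopes**: choosing for each vertex `v` a
regular triangulation `Δ v` of its normal cone and a functional `ξ` generic for all
of them, the indicator function of `P` is the sum of the local contributions. -/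
theorem polar_decomposition_nonsimple {d : ℕ} (hd : 1 ≤ d) (P : Set (Fin d → ℚ))
    (hP : IsPolytope P) (hfull : affineSpan ℚ P = ⊤)
    (Δ : (Fin d → ℚ) → SimplicialFamily d)
    (hΔ : ∀ v, IsVertex P v → IsTriangulationOf (Δ v) (normalCone P v))
    (hreg : ∀ v, IsVertex P v → IsRegularOn (Δ v) (normalCone P v))
    (ξ : Module.Dual ℚ (Fin d → ℚ))
    (α : (v : Fin d → ℚ) → Fin (Δ v).M → Fin d → ℚ)
    (hα : ∀ v, IsVertex P v → ∀ i, ξ = ∑ k, α v i k • (Δ v).w i k)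
    (hgen : ∀ v, IsVertex P v → ∀ i k, α v i k ≠ 0) :
    ∀ x : Fin d → ℚ,
      indicator P x =
        ∑ᶠ v ∈ {v : Fin d → ℚ | IsVertex P v}, localContrib (Δ v) v (α v) x := by
  intro x
  obtain ⟨T, rfl⟩ := hP
  have hT : T.Nonempty := by
    rw [Finset.nonempty_iff_ne_empty]
    rintro rfl
    simp at hfull
  haveI : Nonempty (Fin d) := ⟨⟨0, hd⟩⟩
  have hcard : Fintype.card (Fin d) = Module.finrank ℚ (Module.Dual ℚ (Fin d → ℚ)) := by
    rw [Subspace.dual_finrank_eq]; simp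
  obtain ⟨bs, hbs⟩ : ∃ bs : (v : Fin d → ℚ) → (i : Fin (Δ v).M) →
      Module.Basis (Fin d) ℚ (Module.Dual ℚ (Fin d → ℚ)), ∀ v i k, bs v i k = (Δ v).w i k :=
    ⟨fun v i => basisOfLinearIndependentOfCardEqFinrank ((Δ v).indep i) hcard, by simp⟩
  obtain ⟨VF, hVF⟩ : ∃ VF : Finset (Fin d → ℚ),
      ∀ v, v ∈ VF ↔ IsVertex (convexHull ℚ (T : Set (Fin d → ℚ))) v :=
    ⟨T.filter fun v => IsVertex (convexHull ℚ (T : Set (Fin d → ℚ))) v, fun v => by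
      rw [Finset.mem_filter]
      exact ⟨fun h => h.2, fun h => ⟨h.mem_finset, h⟩⟩⟩
  have hrepr : ∀ v, IsVertex (convexHull ℚ (T : Set (Fin d → ℚ))) v → ∀ i k,
      (bs v i).repr ξ k = α v i k := by
    intro v hv i k
    conv_lhs => rw [hα v hv i]
    simp only [← hbs]
    rw [Module.Basis.repr_sum_self]
  let F : FanData d (convexHull ℚ (T : Set (Fin d → ℚ))) ((v : {v // v ∈ VF}) × Fin (Δ v).M) :=
    { v := fun j => j.1
      b := fun j => bs j.1 j.2
      vP := fun j => ((hVF _).1 j.1.2).mem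
      sub := by
        rintro ⟨⟨v, hv⟩, i⟩ q hq
        have hv' := (hVF v).1 hv
        rw [← (hΔ v hv').1]
        exact Set.mem_iUnion.2 ⟨i, (mem_coneOf_iff (bs v i) _ (hbs v i) q).2 hq⟩
      cov := by
        intro v q hv hq
        rw [← (hΔ v hv).1] at hq
        obtain ⟨i, hi⟩ := Set.mem_iUnion.1 hq
        exact ⟨⟨⟨v, (hVF v).2 hv⟩, i⟩, rfl, (mem_coneOf_iff (bs v i) _ (hbs v i) q).1 hi⟩
      uniq := by
        rintro ⟨⟨v, hv⟩, i⟩ ⟨⟨v', hv'⟩, i'⟩ q hq hq'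
        simp only at hq hq'
        have hv1 := (hVF v).1 hv
        have hv1' := (hVF v').1 hv'
        have hvv : v = v' := by
          have hin : ∀ u, (∀ k, 0 ≤ (bs v i).repr u k) →
              u ∈ normalCone (convexHull ℚ (T : Set (Fin d → ℚ))) v := by
            intro u hu
            rw [← (hΔ v hv1).1]
            exact Set.mem_iUnion.2 ⟨i, (mem_coneOf_iff (bs v i) _ (hbs v i) u).2 hu⟩
          have hin' : ∀ u, (∀ k, 0 ≤ (bs v' i').repr u k) →
              u ∈ normalCone (convexHull ℚ (T : Set (Fin d → ℚ))) v' := by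
            intro u hu
            rw [← (hΔ v' hv1').1]
            exact Set.mem_iUnion.2 ⟨i', (mem_coneOf_iff (bs v' i') _ (hbs v' i') u).2 hu⟩
          have hqq : q v' ≤ q v := hin' q (fun k => (hq' k).le) v hv1.mem
          have hle : ∀ u : Module.Dual ℚ (Fin d → ℚ), u v ≤ u v' := by
            intro u
            obtain ⟨ε, hε, hsm⟩ := exists_small
              (Finset.univ.image fun k => (bs v i).coord k) q u
            have := hin (q + ε • u) (fun k =>
              (((hsm _ (Finset.mem_image_of_mem _ (Finset.mem_univ k))
                (hq k).ne').1).1.2 (hq k)).le) v' hv1'.mem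
            simp only [LinearMap.add_apply, LinearMap.smul_apply, smul_eq_mul] at this
            have h2 : ε * u v ≤ ε * u v' := by linarith
            exact le_of_mul_le_mul_left h2 hε
          ext k
          have h1 := hle (LinearMap.proj k)
          have h2 := hle (-LinearMap.proj k)
          simp at h1 h2
          linarith
        subst hvv
        by_cases hii : i = i'
        · rw [hii]
        · exfalso
          obtain ⟨h, -, ℓ, hℓ, hne⟩ := hreg v hv1
          apply hne i i' hii
          obtain ⟨K, K', hK, hK'⟩ := (hΔ v hv1).2 i i'
          have hmem : q ∈ coneOf ((Δ v).w i) ∩ coneOf ((Δ v).w i') :=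
            ⟨(mem_coneOf_iff (bs v i) _ (hbs v i) q).2 fun k => (hq k).le,
              (mem_coneOf_iff (bs v i') _ (hbs v i') q).2 fun k => (hq' k).le⟩
          have e1 := face_full (bs v i) _ (hbs v i) q hq K (hK ▸ hmem)
          rw [e1] at hK
          apply (bs v i).ext
          intro k
          have hk : bs v i k ∈ coneOf ((Δ v).w i) := by
            rw [mem_coneOf_iff (bs v i) _ (hbs v i)]
            intro k'
            rw [Module.Basis.repr_self, Finsupp.single_apply]
            split_ifs <;> simp
          have hk' : bs v i k ∈ coneOf ((Δ v).w i') := by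
            rw [← hK] at hk
            exact hk.2
          rw [← hℓ i _ hk, ← hℓ i' _ hk'] }
  have main := fan_main hT F ξ (fun j k => by
    have hv := (hVF _).1 j.1.2
    change (bs j.1 j.2).repr ξ k ≠ 0
    rw [hrepr _ hv]
    exact hgen _ hv _ _) x
  have hset : {v : Fin d → ℚ | IsVertex (convexHull ℚ (T : Set (Fin d → ℚ))) v} = ↑VF := by
    ext v
    exact (hVF v).symm
  rw [hset, finsum_mem_coe_finset, ← Finset.sum_coe_sort]
  unfold indicator at *
  rw [← main, Fintype.sum_sigma]
  refine Finset.sum_congr rfl fun v _ => ?_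
  unfold localContrib
  refine Finset.sum_congr rfl fun i _ => ?_
  have hv := (hVF _).1 v.2
  exact (term_eq (bs v i) _ (hbs v i) v x ξ (α v i) (hrepr v hv i) (hgen v hv i)).symm
end
end

section
/- Compatible decomposition from a regular complete fan: Let P ⊆ ℚ^d be a full-dimensional polytope. Suppose σ_1,…,σ_M ⊆ (ℚ^d)^* are simplicial cones (each σ_i = ℚ_{≥0} w^i_1 + … + ℚ_{≥0} w^i_d with w^i_1,…,w^i_d linearly independent) whose union is all of (ℚ^d)^*, such that the intersection of any two is a face of each, each σ_i is contained in the normal cone N_v of some vertex v of P, and there is a convex function h : (ℚ^d)^* → ℚ together with linear functionals ℓ_1,…,ℓ_M with h = ℓ_i on σ_i and ℓ_i ≠ ℓ_j for i ≠ j. For each vertex v let Δ_v = {σ_i : σ_i ⊆ N_v} (a regular triangulation of N_v). Then for every ξ ∈ (ℚ^d)^* generic for all Δ_v, 1_P = Σ_{v vertex of P} 1^ξ_{Δ_v,v}, as functions ℚ^d → ℤ. -/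
noncomputable section
open Classical

open scoped BigOperators

open Filter Topology

theorem farkas_aux {V ι : Type*} [AddCommGroup V] [Module ℚ V] (s : Finset ι) :
    ∀ (a : ι → V →ₗ[ℚ] ℚ) (b : V →ₗ[ℚ] ℚ),
      (∀ y, (∀ i ∈ s, a i y ≤ 0) → b y ≤ 0) →
      ∃ c : ι → ℚ, (∀ i ∈ s, 0 ≤ c i) ∧ b = ∑ i ∈ s, c i • a i := by
  induction s using Finset.induction_on with
  | empty =>
    intro a b h
    refine ⟨0, by simp, ?_⟩
    ext y
    have h1 := h y (by simp)
    have h2 := h (-y) (by simp)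
    simp at h2 ⊢
    linarith
  | insert m s hm ih =>
    intro a b h
    by_cases hs : ∀ y, (∀ i ∈ s, a i y ≤ 0) → b y ≤ 0
    · obtain ⟨c, hc, hb⟩ := ih a b hs
      refine ⟨fun i => if i = m then 0 else c i, ?_, ?_⟩
      · intro i hi
        by_cases him : i = m
        · simp [him]
        · simp only [him, if_false]
          exact hc i (by simpa [him] using hi)
      · rw [Finset.sum_insert hm, hb]
        simp only [if_true, zero_smul, zero_add]
        refine Finset.sum_congr rfl fun i hi => ?_
        have : i ≠ m := fun h => hm (h ▸ hi)
        simp [this]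
    · push Not at hs
      obtain ⟨y1, hy1, hby1⟩ := hs
      have hpos : 0 < a m y1 := by
        by_contra hcon
        have := h y1 (by
          intro i hi
          rcases Finset.mem_insert.1 hi with rfl | hi
          · exact not_lt.1 hcon
          · exact hy1 i hi)
        linarith
      obtain ⟨y0, hy0, hby0, hm0⟩ : ∃ y0, (∀ i ∈ s, a i y0 ≤ 0) ∧ 0 < b y0 ∧ a m y0 = 1 := by
        refine ⟨(a m y1)⁻¹ • y1, ?_, ?_, ?_⟩
        · intro i hi
          simp only [map_smul, smul_eq_mul]
          exact mul_nonpos_of_nonneg_of_nonpos (inv_pos.2 hpos).le (hy1 i hi)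
        · simp only [map_smul, smul_eq_mul]
          exact mul_pos (inv_pos.2 hpos) hby1
        · simp only [map_smul, smul_eq_mul]
          exact inv_mul_cancel₀ hpos.ne'
      obtain ⟨c, hc, hb⟩ := ih (fun i => a i - a i y0 • a m) (b - b y0 • a m) (by
        intro y hy
        have := h (y - a m y • y0) (by
          intro i hi
          rcases Finset.mem_insert.1 hi with rfl | hi
          · simp [hm0]
          · have := hy i hi
            simp at this ⊢
            linarith)
        simp at this ⊢
        linarith)
      refine ⟨fun i => if i = m then b y0 - ∑ j ∈ s, c j * a j y0 else c i, ?_, ?_⟩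
      · intro i hi
        by_cases him : i = m
        · simp only [him, if_true]
          have : ∑ j ∈ s, c j * a j y0 ≤ 0 :=
            Finset.sum_nonpos fun j hj => mul_nonpos_of_nonneg_of_nonpos (hc j hj) (hy0 j hj)
          linarith
        · simp only [him, if_false]
          exact hc i (by simpa [him] using hi)
      · rw [Finset.sum_insert hm]
        simp only [if_true]
        have e : ∑ i ∈ s, (if i = m then b y0 - ∑ j ∈ s, c j * a j y0 else c i) • a i
            = ∑ i ∈ s, c i • a i := by
          refine Finset.sum_congr rfl fun i hi => ?_
          have : i ≠ m := fun h => hm (h ▸ hi)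
          simp [this]
        rw [e]
        ext y
        have := congrArg (fun f => f y) hb
        simp [mul_sub, Finset.sum_sub_distrib] at this ⊢
        have e2 : ∑ j ∈ s, c j * (a j y0 * a m y) = (∑ j ∈ s, c j * a j y0) * a m y := by
          rw [Finset.sum_mul]; exact Finset.sum_congr rfl fun _ _ => by ring
        rw [e2] at this
        linarith

theorem separation_aux {d : ℕ} (T : Finset (Fin d → ℚ)) (x : Fin d → ℚ)
    (hx : x ∉ convexHull ℚ (T : Set (Fin d → ℚ))) :
    ∃ n : Module.Dual ℚ (Fin d → ℚ), ∀ t ∈ T, n x < n t := by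
  by_contra hcon
  push Not at hcon
  apply hx
  let ev : (Fin d → ℚ) → (Module.Dual ℚ (Fin d → ℚ) × ℚ) →ₗ[ℚ] ℚ := fun t =>
    (Module.Dual.eval ℚ (Fin d → ℚ) t).comp (LinearMap.fst ℚ _ _) + LinearMap.snd ℚ _ _
  have hev : ∀ t n c, ev t (n, c) = n t + c := fun t n c => by simp [ev]
  obtain ⟨c, hc, hb⟩ := farkas_aux T ev (ev x) (by
    rintro ⟨n, c⟩ h
    obtain ⟨t, ht, hle⟩ := hcon (-n)
    have := h t ht
    rw [hev] at *
    simp at hle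
    linarith)
  have h1 : ∑ t ∈ T, c t = 1 := by
    have := congrArg (fun f => f (0, 1)) hb
    simp [hev] at this
    exact this.symm
  have h2 : x = ∑ t ∈ T, c t • t := by
    ext k
    have := congrArg (fun f => f (LinearMap.proj k, 0)) hb
    simp [hev] at this
    simpa using this
  rw [h2]
  exact (convex_convexHull ℚ _).sum_mem hc h1 fun t ht => subset_convexHull ℚ _ ht

/-- The basis of the dual space given by the `i`-th cone. -/
def fanBasis {d : ℕ} (Fan : SimplicialFamily d) (i : Fin Fan.M) :
    Module.Basis (Fin d) ℚ (Module.Dual ℚ (Fin d → ℚ)) :=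
  haveI : Nonempty (Fin d) ∨ IsEmpty (Fin d) := (isEmpty_or_nonempty _).symm
  Module.Basis.mk (Fan.indep i) (by
    have := (Fan.indep i).span_eq_top_of_card_eq_finrank' (by simp)
    exact this.ge)

/-- Coordinates. -/
def crd {d : ℕ} (Fan : SimplicialFamily d) (i : Fin Fan.M) :
    Module.Dual ℚ (Fin d → ℚ) →ₗ[ℚ] (Fin d → ℚ) :=
  (fanBasis Fan i).equivFun.toLinearMap

theorem crd_sum {d : ℕ} (Fan : SimplicialFamily d) (i : Fin Fan.M)
    (n : Module.Dual ℚ (Fin d → ℚ)) : n = ∑ k, crd Fan i n k • Fan.w i k := by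
  conv_lhs => rw [← (fanBasis Fan i).sum_equivFun n]
  simp [crd, fanBasis]

theorem crd_unique {d : ℕ} (Fan : SimplicialFamily d) (i : Fin Fan.M)
    (c : Fin d → ℚ) : crd Fan i (∑ k, c k • Fan.w i k) = c := by
  have : ∑ k, c k • Fan.w i k = (fanBasis Fan i).equivFun.symm c := by
    rw [Module.Basis.equivFun_symm_apply]; simp [fanBasis]
  rw [this]; exact (fanBasis Fan i).equivFun.apply_symm_apply c

theorem mem_coneOf {d : ℕ} (Fan : SimplicialFamily d) (i : Fin Fan.M)
    (n : Module.Dual ℚ (Fin d → ℚ)) : n ∈ coneOf (Fan.w i) ↔ ∀ k, 0 ≤ crd Fan i n k := by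
  constructor
  · rintro ⟨c, hc, rfl⟩ k
    rw [crd_unique]; exact hc k
  · intro h
    exact ⟨_, h, crd_sum Fan i n⟩

theorem mem_coneFaceOf {d : ℕ} (Fan : SimplicialFamily d) (i : Fin Fan.M) (K : Finset (Fin d))
    (n : Module.Dual ℚ (Fin d → ℚ)) : n ∈ coneFaceOf (Fan.w i) K ↔
      (∀ k, 0 ≤ crd Fan i n k) ∧ ∀ k ∈ K, crd Fan i n k = 0 := by
  constructor
  · rintro ⟨c, hc, hK, rfl⟩
    rw [crd_unique]; exact ⟨hc, hK⟩
  · intro h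
    exact ⟨_, h.1, h.2, crd_sum Fan i n⟩

theorem crd_w {d : ℕ} (Fan : SimplicialFamily d) (i : Fin Fan.M) (k : Fin d) :
    crd Fan i (Fan.w i k) = Pi.single k 1 := by
  have := crd_unique Fan i (Pi.single k 1)
  rw [← this]
  congr 1
  simp [Pi.single_apply]

/-- Sum of generators in `S`. -/
def bary {d : ℕ} (Fan : SimplicialFamily d) (i : Fin Fan.M) (S : Finset (Fin d)) :
    Module.Dual ℚ (Fin d → ℚ) := ∑ k, (if k ∈ S then (1 : ℚ) else 0) • Fan.w i k

theorem crd_bary {d : ℕ} (Fan : SimplicialFamily d) (i : Fin Fan.M) (S : Finset (Fin d)) :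
    crd Fan i (bary Fan i S) = fun k => if k ∈ S then (1 : ℚ) else 0 := by
  unfold bary
  exact crd_unique Fan i _

theorem bary_mem {d : ℕ} (Fan : SimplicialFamily d) (i : Fin Fan.M) (S : Finset (Fin d)) :
    bary Fan i S ∈ coneFaceOf (Fan.w i) Sᶜ := by
  rw [mem_coneFaceOf, crd_bary]
  constructor
  · intro k; dsimp only; split_ifs <;> norm_num
  · intro k hk; simp at hk; simp [hk]

theorem face_finrank {d : ℕ} (Fan : SimplicialFamily d) (i : Fin Fan.M) (S : Finset (Fin d)) :
    Module.finrank ℚ (Submodule.span ℚ (coneFaceOf (Fan.w i) Sᶜ)) = S.card := by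
  have h : Submodule.span ℚ (coneFaceOf (Fan.w i) Sᶜ)
      = Submodule.span ℚ (Set.range fun k : S => Fan.w i k) := by
    apply le_antisymm
    · rw [Submodule.span_le]
      rintro n ⟨c, hc, hK, rfl⟩
      refine Submodule.sum_mem _ fun k _ => ?_
      by_cases hk : k ∈ S
      · exact Submodule.smul_mem _ _ (Submodule.subset_span ⟨⟨k, hk⟩, rfl⟩)
      · rw [hK k (by simpa using hk)]; simp
    · rw [Submodule.span_le]
      rintro _ ⟨⟨k, hk⟩, rfl⟩
      apply Submodule.subset_span
      rw [mem_coneFaceOf, crd_w]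
      constructor
      · intro j; simp only [Pi.single_apply]; split_ifs <;> norm_num
      · intro j hj
        have : j ≠ k := by rintro rfl; simp at hj; exact hj hk
        simp [this]
  rw [h]
  have := finrank_span_eq_card ((Fan.indep i).comp (fun k : S => (k : Fin d))
    Subtype.val_injective)
  simpa [Function.comp_def] using this

theorem ev_pos (a b : ℚ) (ha : 0 < a) : ∀ᶠ e in 𝓝[>] (0:ℚ), 0 < a + e * b := by
  apply Filter.Eventually.filter_mono nhdsWithin_le_nhds
  have : ContinuousAt (fun e : ℚ => a + e * b) 0 := by fun_prop
  exact this.eventually_const_lt (by simpa using ha)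

theorem ev_pos' (a b : ℚ) (ha : 0 ≤ a) (hb : a = 0 → 0 < b) :
    ∀ᶠ e in 𝓝[>] (0:ℚ), 0 < a + e * b := by
  rcases ha.lt_or_eq with ha | ha
  · exact ev_pos a b ha
  · filter_upwards [self_mem_nhdsWithin] with e he
    rw [← ha, zero_add]
    exact mul_pos he (hb ha.symm)

theorem ev_ne (a b : ℚ) (hb : b ≠ 0) : ∀ᶠ e in 𝓝[>] (0:ℚ), a + e * b ≠ 0 := by
  rcases lt_trichotomy a 0 with ha | ha | ha
  · filter_upwards [ev_pos (-a) (-b) (by linarith)] with e he h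
    linarith
  · filter_upwards [self_mem_nhdsWithin] with e he
    rw [ha, zero_add]
    exact mul_ne_zero (ne_of_gt he) hb
  · filter_upwards [ev_pos a b ha] with e he
    exact he.ne'

theorem int_disjoint {d : ℕ} (Fan : SimplicialFamily d)
    (hfan : ∀ i j, ∃ K K' : Finset (Fin d),
      coneOf (Fan.w i) ∩ coneOf (Fan.w j) = coneFaceOf (Fan.w i) K ∧
      coneOf (Fan.w i) ∩ coneOf (Fan.w j) = coneFaceOf (Fan.w j) K')
    (hreg : IsRegularOn Fan (Set.univ : Set (Module.Dual ℚ (Fin d → ℚ))))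
    (i j : Fin Fan.M) (q : Module.Dual ℚ (Fin d → ℚ))
    (hi : ∀ k, 0 < crd Fan i q k) (hj : ∀ k, 0 < crd Fan j q k) : i = j := by
  obtain ⟨h, -, l, hl, hne⟩ := hreg
  by_contra hij
  apply hne i j hij
  obtain ⟨K, K', h1, -⟩ := hfan i j
  have hq : q ∈ coneOf (Fan.w i) ∩ coneOf (Fan.w j) :=
    ⟨(mem_coneOf _ _ _).2 fun k => (hi k).le, (mem_coneOf _ _ _).2 fun k => (hj k).le⟩
  rw [h1, mem_coneFaceOf] at hq
  have hK : ∀ k, k ∉ K := fun k hk => (hi k).ne' (hq.2 k hk)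
  apply (fanBasis Fan i).ext
  intro k
  have hb : fanBasis Fan i k = Fan.w i k := by simp [fanBasis]
  rw [hb]
  have hm : Fan.w i k ∈ coneFaceOf (Fan.w i) K := by
    rw [mem_coneFaceOf, crd_w]
    constructor
    · intro j; simp only [Pi.single_apply]; split_ifs <;> norm_num
    · intro j hj; exact absurd hj (hK j)
  rw [← h1] at hm
  rw [← hl i _ hm.1, hl j _ hm.2]

theorem face_sub {d : ℕ} (Fan : SimplicialFamily d)
    (hfan : ∀ i j, ∃ K K' : Finset (Fin d),
      coneOf (Fan.w i) ∩ coneOf (Fan.w j) = coneFaceOf (Fan.w i) K ∧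
      coneOf (Fan.w i) ∩ coneOf (Fan.w j) = coneFaceOf (Fan.w j) K')
    (i j : Fin Fan.M) (S S' : Finset (Fin d)) (p : Module.Dual ℚ (Fin d → ℚ))
    (hp : ∀ k, 0 ≤ crd Fan i p k) (hp' : ∀ k, 0 ≤ crd Fan j p k)
    (hS : ∀ k, k ∈ S ↔ 0 < crd Fan i p k) (hS' : ∀ k, k ∈ S' ↔ 0 < crd Fan j p k) :
    coneFaceOf (Fan.w i) Sᶜ ⊆ coneFaceOf (Fan.w j) S'ᶜ := by
  obtain ⟨K, K', h1, -⟩ := hfan i j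
  have hpm : p ∈ coneOf (Fan.w i) ∩ coneOf (Fan.w j) :=
    ⟨(mem_coneOf _ _ _).2 hp, (mem_coneOf _ _ _).2 hp'⟩
  rw [h1, mem_coneFaceOf] at hpm
  have key : ∀ n ∈ coneFaceOf (Fan.w i) Sᶜ, n ∈ coneOf (Fan.w j) := by
    intro n hn
    rw [mem_coneFaceOf] at hn
    have : n ∈ coneFaceOf (Fan.w i) K := by
      rw [mem_coneFaceOf]
      refine ⟨hn.1, fun k hk => hn.2 k ?_⟩
      simp [hS, hpm.2 k hk]
    rw [← h1] at this
    exact this.2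
  intro n hn
  have hnj := key n hn
  rw [mem_coneOf] at hnj
  rw [mem_coneFaceOf] at hn ⊢
  refine ⟨hnj, ?_⟩
  have : ∀ᶠ e in 𝓝[>] (0:ℚ), ∀ k ∈ S, 0 < crd Fan i p k + e * (- crd Fan i n k) := by
    rw [Filter.eventually_all_finset]
    intro k hk
    exact ev_pos _ _ ((hS k).1 hk)
  obtain ⟨e, he, hepos⟩ := (this.and self_mem_nhdsWithin).exists
  have hepos : 0 < e := hepos
  have hz := key (p - e • n) (by
    rw [mem_coneFaceOf]
    have hout : ∀ k ∈ Sᶜ, crd Fan i (p - e • n) k = 0 := by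
      intro k hk
      have h0 : crd Fan i p k = 0 := by
        have : ¬ 0 < crd Fan i p k := by rw [← hS]; simpa using hk
        exact le_antisymm (not_lt.1 this) (hp k)
      simp [h0, hn.2 k hk]
    refine ⟨fun k => ?_, hout⟩
    by_cases hk : k ∈ S
    · have := he k hk
      simp
      linarith
    · exact (hout k (by simpa using hk)).ge)
  rw [mem_coneOf] at hz
  intro k hk
  have h0 : crd Fan j p k = 0 := by
    have : ¬ 0 < crd Fan j p k := by rw [← hS']; simpa using hk
    exact le_antisymm (not_lt.1 this) (hp' k)
  have h3 := hz k
  simp [h0] at h3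
  have h4 := hnj k
  nlinarith

/-- The signed term of the `i`-th cone. -/
def fterm {d : ℕ} (Fan : SimplicialFamily d) (v : Fin Fan.M → Fin d → ℚ) (x : Fin d → ℚ)
    (ξ : Module.Dual ℚ (Fin d → ℚ)) (i : Fin Fan.M) : ℤ :=
  ∏ k, ((if Fan.w i k (v i) ≤ Fan.w i k x then (1 : ℤ) else 0) +
    (if crd Fan i ξ k < 0 then (-1 : ℤ) else 0))

/-- The value of a face. -/
def fval {d : ℕ} (P : Set (Fin d → ℚ)) (x : Fin d → ℚ)
    (τ : Set (Module.Dual ℚ (Fin d → ℚ))) : ℤ :=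
  (if ∀ n ∈ τ, ∃ y ∈ P, n y ≤ n x then (1 : ℤ) else 0) *
    (-1) ^ (d - Module.finrank ℚ (Submodule.span ℚ τ))

theorem fval_face {d : ℕ} (Fan : SimplicialFamily d) (P : Set (Fin d → ℚ)) (x : Fin d → ℚ)
    (v : Fin Fan.M → Fin d → ℚ) (hv : ∀ i, v i ∈ P)
    (hN : ∀ i, coneOf (Fan.w i) ⊆ normalCone P (v i)) (i : Fin Fan.M) (S : Finset (Fin d)) :
    fval P x (coneFaceOf (Fan.w i) Sᶜ) =
      (∏ k ∈ S, (if Fan.w i k (v i) ≤ Fan.w i k x then (1 : ℤ) else 0)) * (-1) ^ Sᶜ.card := by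
  unfold fval
  rw [face_finrank, Finset.card_compl, Fintype.card_fin]
  congr 1
  have : (∀ n ∈ coneFaceOf (Fan.w i) Sᶜ, ∃ y ∈ P, n y ≤ n x) ↔
      ∀ k ∈ S, Fan.w i k (v i) ≤ Fan.w i k x := by
    have hw : ∀ k, ∀ j, 0 ≤ crd Fan i (Fan.w i k) j := by
      intro k j
      rw [crd_w]; simp only [Pi.single_apply]; split_ifs <;> norm_num
    constructor
    · intro h k hk
      obtain ⟨y, hy, hle⟩ := h (Fan.w i k) (by
        rw [mem_coneFaceOf]
        refine ⟨hw k, ?_⟩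
        rw [crd_w]
        intro j hj
        have : j ≠ k := by rintro rfl; simp at hj; exact hj hk
        simp [this])
      exact (hN i ((mem_coneOf _ _ _).2 (hw k)) y hy).trans hle
    · rintro h n ⟨c, hc, hK, rfl⟩
      refine ⟨v i, hv i, ?_⟩
      simp only [LinearMap.sum_apply, LinearMap.smul_apply, smul_eq_mul]
      refine Finset.sum_le_sum fun k _ => ?_
      by_cases hk : k ∈ S
      · exact mul_le_mul_of_nonneg_left (h k hk) (hc k)
      · rw [hK k (by simpa using hk)]; simp
  rw [Finset.prod_ite_zero]
  simp only [this, Finset.prod_const_one]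

theorem fterm_expand {d : ℕ} (Fan : SimplicialFamily d) (P : Set (Fin d → ℚ)) (x : Fin d → ℚ)
    (v : Fin Fan.M → Fin d → ℚ) (hv : ∀ i, v i ∈ P)
    (hN : ∀ i, coneOf (Fan.w i) ⊆ normalCone P (v i)) (ξ : Module.Dual ℚ (Fin d → ℚ))
    (i : Fin Fan.M) :
    fterm Fan v x ξ i = ∑ S ∈ (Finset.univ : Finset (Finset (Fin d))).filter
        (fun S => ∀ k ∈ Sᶜ, crd Fan i ξ k < 0),
      fval P x (coneFaceOf (Fan.w i) Sᶜ) := by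
  unfold fterm
  rw [Fintype.prod_add, Finset.sum_filter]
  refine Finset.sum_congr rfl fun S _ => ?_
  rw [fval_face Fan P x v hv hN i S, Finset.prod_ite_zero (s := Sᶜ)]
  split_ifs <;> simp

theorem fsum_eq {d : ℕ} (Fan : SimplicialFamily d) (P : Set (Fin d → ℚ)) (x : Fin d → ℚ)
    (hcomplete : (⋃ i, coneOf (Fan.w i)) = (Set.univ : Set (Module.Dual ℚ (Fin d → ℚ))))
    (hfan : ∀ i j, ∃ K K' : Finset (Fin d),
      coneOf (Fan.w i) ∩ coneOf (Fan.w j) = coneFaceOf (Fan.w i) K ∧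
      coneOf (Fan.w i) ∩ coneOf (Fan.w j) = coneFaceOf (Fan.w j) K')
    (hreg : IsRegularOn Fan (Set.univ : Set (Module.Dual ℚ (Fin d → ℚ))))
    (v : Fin Fan.M → Fin d → ℚ) (hv : ∀ i, v i ∈ P)
    (hN : ∀ i, coneOf (Fan.w i) ⊆ normalCone P (v i)) (ξ : Module.Dual ℚ (Fin d → ℚ))
    (hgen : ∀ i k, crd Fan i ξ k ≠ 0) :
    ∑ i, fterm Fan v x ξ i =
      ∑ τ ∈ (Finset.univ : Finset (Fin Fan.M × Finset (Fin d))).image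
        (fun q => coneFaceOf (Fan.w q.1) q.2ᶜ), fval P x τ := by
  simp only [fterm_expand Fan P x v hv hN]
  rw [Finset.sum_sigma']
  refine Finset.sum_bij (fun q _ => coneFaceOf (Fan.w q.1) q.2ᶜ) ?_ ?_ ?_ ?_
  · intro q _
    exact Finset.mem_image.2 ⟨(q.1, q.2), Finset.mem_univ _, rfl⟩
  · rintro ⟨i, S⟩ hi ⟨j, S'⟩ hj heq
    simp only [Finset.mem_sigma, Finset.mem_univ, Finset.mem_filter, true_and] at hi hj
    dsimp only at heq
    set p := bary Fan i S + bary Fan j S' with hpdef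
    have c1 := bary_mem Fan i S
    have c2 := bary_mem Fan j S'
    have c1' := c1
    have c2' := c2
    rw [heq] at c1'
    rw [← heq] at c2'
    rw [mem_coneFaceOf] at c1 c2 c1' c2'
    have pi : (∀ k ∈ S, 0 < crd Fan i p k) ∧ ∀ k ∈ Sᶜ, crd Fan i p k = 0 := by
      constructor
      · intro k hk
        have := c2'.1 k
        simp [hpdef, crd_bary, hk]
        linarith
      · intro k hk
        simp [hpdef, c1.2 k hk, c2'.2 k hk]
    have pj : (∀ k ∈ S', 0 < crd Fan j p k) ∧ ∀ k ∈ S'ᶜ, crd Fan j p k = 0 := by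
      constructor
      · intro k hk
        have := c1'.1 k
        simp [hpdef, crd_bary, hk]
        linarith
      · intro k hk
        simp [hpdef, c2.2 k hk, c1'.2 k hk]
    have ev : ∀ (i : Fin Fan.M) (S : Finset (Fin d)), (∀ k ∈ Sᶜ, crd Fan i ξ k < 0) →
        ((∀ k ∈ S, 0 < crd Fan i p k) ∧ ∀ k ∈ Sᶜ, crd Fan i p k = 0) →
        ∀ᶠ e in 𝓝[>] (0:ℚ), ∀ k, 0 < crd Fan i (p - e • ξ) k := by
      intro i S h1 h2
      rw [Filter.eventually_all]
      intro k
      have : ∀ᶠ e in 𝓝[>] (0:ℚ), 0 < crd Fan i p k + e * (- crd Fan i ξ k) := by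
        by_cases hk : k ∈ S
        · exact ev_pos _ _ (h2.1 k hk)
        · have hk : k ∈ Sᶜ := by simpa using hk
          exact ev_pos' _ _ (h2.2 k hk).ge fun _ => by have := h1 k hk; linarith
      filter_upwards [this] with e he
      simp
      linarith
    obtain ⟨e, he1, he2⟩ := ((ev i S hi pi).and (ev j S' hj pj)).exists
    obtain rfl := int_disjoint Fan hfan hreg i j _ he1 he2
    have : S = S' := by
      ext k
      constructor
      · intro hk
        by_contra hk'
        exact (pi.1 k hk).ne' (pj.2 k (by simpa using hk'))
      · intro hk
        by_contra hk'
        exact (pj.1 k hk).ne' (pi.2 k (by simpa using hk'))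
    rw [this]
  · intro τ hτ
    obtain ⟨⟨j, S'⟩, -, rfl⟩ := Finset.mem_image.1 hτ
    dsimp only
    set p := bary Fan j S' with hpdef
    have hex : ∃ i, ∃ᶠ e in 𝓝[>] (0:ℚ), p - e • ξ ∈ coneOf (Fan.w i) := by
      by_contra hcon
      simp only [not_exists, Filter.not_frequently] at hcon
      rw [← Filter.eventually_all] at hcon
      obtain ⟨e, he⟩ := hcon.exists
      have : p - e • ξ ∈ ⋃ i, coneOf (Fan.w i) := by rw [hcomplete]; trivial
      obtain ⟨i, hi⟩ := Set.mem_iUnion.1 this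
      exact he i hi
    obtain ⟨i, hi⟩ := hex
    have hp : ∀ k, 0 ≤ crd Fan i p k := by
      intro k
      by_contra hneg
      obtain ⟨e, he1, he2⟩ :=
        (hi.and_eventually (ev_pos (- crd Fan i p k) (crd Fan i ξ k) (by linarith))).exists
      have := (mem_coneOf _ _ _).1 he1 k
      simp at this
      linarith
    have hp0 : ∀ k, crd Fan i p k = 0 → crd Fan i ξ k < 0 := by
      intro k hk
      obtain ⟨e, he1, he2⟩ := (hi.and_eventually self_mem_nhdsWithin).exists
      have he2 : 0 < e := he2
      have := (mem_coneOf _ _ _).1 he1 k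
      simp [hk] at this
      refine lt_of_le_of_ne ?_ (hgen i k)
      by_contra hpos
      nlinarith
    have hS : ∀ k, k ∈ Finset.univ.filter (fun k => 0 < crd Fan i p k) ↔ 0 < crd Fan i p k := by
      simp
    have hp' : ∀ k, 0 ≤ crd Fan j p k := ((mem_coneFaceOf _ _ _ _).1 (bary_mem Fan j S')).1
    have hS' : ∀ k, k ∈ S' ↔ 0 < crd Fan j p k := by
      intro k
      rw [hpdef, crd_bary]
      by_cases hk : k ∈ S' <;> simp [hk]
    refine ⟨⟨i, Finset.univ.filter (fun k => 0 < crd Fan i p k)⟩, ?_, ?_⟩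
    · simp only [Finset.mem_sigma, Finset.mem_univ, Finset.mem_filter, true_and]
      intro k hk
      apply hp0
      have : ¬ 0 < crd Fan i p k := by simpa using hk
      exact le_antisymm (not_lt.1 this) (hp k)
    · exact Set.Subset.antisymm (face_sub Fan hfan _ _ _ _ p hp hp' hS hS')
        (face_sub Fan hfan _ _ _ _ p hp' hp hS' hS)
  · intro q _
    rfl

theorem fterm_eq {d : ℕ} (Fan : SimplicialFamily d) (x : Fin d → ℚ)
    (v : Fin Fan.M → Fin d → ℚ) (ξ : Module.Dual ℚ (Fin d → ℚ))
    (hgen : ∀ i k, crd Fan i ξ k ≠ 0) (i : Fin Fan.M) :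
    (-1 : ℤ) ^ indOf (crd Fan i ξ) * indicator (polarCone (v i) (Fan.w i) (crd Fan i ξ)) x
      = fterm Fan v x ξ i := by
  have h1 : (-1 : ℤ) ^ indOf (crd Fan i ξ) = ∏ k, (if crd Fan i ξ k < 0 then (-1 : ℤ) else 1) := by
    unfold indOf
    rw [Finset.prod_ite]; simp
  have h2 : indicator (polarCone (v i) (Fan.w i) (crd Fan i ξ)) x =
      ∏ k, (if ((0 < crd Fan i ξ k → Fan.w i k (v i) ≤ Fan.w i k x) ∧
        (crd Fan i ξ k < 0 → Fan.w i k x < Fan.w i k (v i))) then (1 : ℤ) else 0) := by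
    rw [Finset.prod_ite_zero]
    simp only [Finset.mem_univ, true_imp_iff, Finset.prod_const_one]
    by_cases hx : x ∈ polarCone (v i) (Fan.w i) (crd Fan i ξ)
    · rw [indicator, if_pos hx, if_pos]
      exact hx
    · rw [indicator, if_neg hx, if_neg]
      exact hx
  rw [h1, h2, ← Finset.prod_mul_distrib]
  unfold fterm
  refine Finset.prod_congr rfl fun k _ => ?_
  rcases lt_or_gt_of_ne (hgen i k) with h | h
  · by_cases hle : Fan.w i k (v i) ≤ Fan.w i k x
    · simp [h, hle, h.not_gt]
    · simp [h, hle, h.not_gt, not_le.1 hle]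
  · by_cases hle : Fan.w i k (v i) ≤ Fan.w i k x
    · simp [h, hle, h.not_gt]
    · simp [h, hle, h.not_gt]

theorem compatible_decomposition {d : ℕ} (hd : 1 ≤ d) (P : Set (Fin d → ℚ))
    (hP : IsPolytope P) (hfull : affineSpan ℚ P = ⊤)
    (Fan : SimplicialFamily d)
    (hcomplete : (⋃ i, coneOf (Fan.w i)) = (Set.univ : Set (Module.Dual ℚ (Fin d → ℚ))))
    (hfan : ∀ i j, ∃ K K' : Finset (Fin d),
      coneOf (Fan.w i) ∩ coneOf (Fan.w j) = coneFaceOf (Fan.w i) K ∧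
      coneOf (Fan.w i) ∩ coneOf (Fan.w j) = coneFaceOf (Fan.w j) K')
    (hrefine : ∀ i, ∃ v, IsVertex P v ∧ coneOf (Fan.w i) ⊆ normalCone P v)
    (hreg : IsRegularOn Fan (Set.univ : Set (Module.Dual ℚ (Fin d → ℚ))))
    (ξ : Module.Dual ℚ (Fin d → ℚ))
    (α : Fin Fan.M → Fin d → ℚ) (hα : ∀ i, ξ = ∑ k, α i k • Fan.w i k)
    (hgen : ∀ i k, α i k ≠ 0) :
    ∀ x : Fin d → ℚ,
      indicator P x =
        ∑ᶠ v ∈ {v : Fin d → ℚ | IsVertex P v},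
          ∑ i ∈ Finset.univ.filter (fun i => coneOf (Fan.w i) ⊆ normalCone P v),
            (-1 : ℤ) ^ indOf (α i) * indicator (polarCone v (Fan.w i) (α i)) x := by
  intro x
  obtain rfl : α = fun i => crd Fan i ξ := by
    funext i
    conv_rhs => rw [hα i]
    rw [crd_unique]
  dsimp only at hgen ⊢
  choose v hvert hN using hrefine
  have hmem : ∀ u, IsVertex P u → u ∈ P := by
    rintro u ⟨l, hl⟩
    have : u ∈ ({u} : Set (Fin d → ℚ)) := rfl
    rw [hl] at this
    exact this.1
  have hv : ∀ i, v i ∈ P := fun i => hmem _ (hvert i)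
  have hwcone : ∀ i k, Fan.w i k ∈ coneOf (Fan.w i) := by
    intro i k
    rw [mem_coneOf, crd_w]
    intro j
    simp only [Pi.single_apply]; split_ifs <;> norm_num
  have huniq : ∀ i u, IsVertex P u → coneOf (Fan.w i) ⊆ normalCone P u → u = v i := by
    intro i u hu hsub
    have hw : ∀ k, Fan.w i k u = Fan.w i k (v i) := fun k =>
      le_antisymm (hsub (hwcone i k) _ (hv i)) (hN i (hwcone i k) _ (hmem u hu))
    ext j
    have h1 := crd_sum Fan i (LinearMap.proj j)
    have e1 := congrArg (fun f => f u) h1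
    have e2 := congrArg (fun f => f (v i)) h1
    simp only [LinearMap.sum_apply, LinearMap.smul_apply, hw, LinearMap.proj_apply] at e1 e2
    exact e1.trans e2.symm
  have hsum : (∑ᶠ u ∈ {u : Fin d → ℚ | IsVertex P u},
          ∑ i ∈ Finset.univ.filter (fun i => coneOf (Fan.w i) ⊆ normalCone P u),
            (-1 : ℤ) ^ indOf (crd Fan i ξ) * indicator (polarCone u (Fan.w i) (crd Fan i ξ)) x)
      = ∑ i, fterm Fan v x ξ i := by
    have hV : ∀ u, IsVertex P u →
        (∑ i ∈ Finset.univ.filter (fun i => coneOf (Fan.w i) ⊆ normalCone P u),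
            (-1 : ℤ) ^ indOf (crd Fan i ξ) * indicator (polarCone u (Fan.w i) (crd Fan i ξ)) x)
          = ∑ i ∈ Finset.univ.filter (fun i => v i = u), fterm Fan v x ξ i := by
      intro u hu
      refine Finset.sum_congr ?_ ?_
      · ext i
        simp only [Finset.mem_filter, Finset.mem_univ, true_and]
        constructor
        · intro h; exact (huniq i u hu h).symm
        · rintro rfl; exact hN i
      · intro i hi
        have hi : v i = u := by simpa using hi
        rw [← fterm_eq Fan x v ξ hgen i, hi]
    rw [finsum_mem_congr (s := {u : Fin d → ℚ | IsVertex P u}) rfl (fun u hu => hV u hu),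
      finsum_mem_eq_sum_of_inter_support_eq (t := Finset.univ.image v)]
    · exact Finset.sum_fiberwise_of_maps_to (fun i _ => Finset.mem_image_of_mem v (Finset.mem_univ i)) _
    · ext u
      simp only [Set.mem_inter_iff, Set.mem_ofPred_eq, Function.mem_support, Finset.coe_image,
        Finset.coe_univ, Set.image_univ, Set.mem_range]
      constructor
      · rintro ⟨h1, h2⟩
        refine ⟨?_, h2⟩
        obtain ⟨i, hi, -⟩ := Finset.exists_ne_zero_of_sum_ne_zero h2
        exact ⟨i, by simpa using hi⟩
      · rintro ⟨⟨i, rfl⟩, h2⟩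
        exact ⟨hvert i, h2⟩
  rw [hsum]
  by_cases hx : x ∈ P
  · have hle : ∀ i k, Fan.w i k (v i) ≤ Fan.w i k x := fun i k => hN i (hwcone i k) x hx
    have : ξ ∈ ⋃ i, coneOf (Fan.w i) := by rw [hcomplete]; trivial
    obtain ⟨i, hi⟩ := Set.mem_iUnion.1 this
    rw [mem_coneOf] at hi
    have hi : ∀ k, 0 < crd Fan i ξ k := fun k => lt_of_le_of_ne (hi k) (hgen i k).symm
    rw [Finset.sum_eq_single i]
    · unfold fterm
      simp [indicator, hx, hle, fun k => (hi k).not_gt]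
    · intro j _ hji
      by_contra hne
      apply hji
      refine int_disjoint Fan hfan hreg j i ξ (fun k => ?_) hi
      by_contra hk
      apply hne
      have : crd Fan j ξ k < 0 := lt_of_le_of_ne (not_lt.1 hk) (hgen j k)
      exact Finset.prod_eq_zero (Finset.mem_univ k) (by simp [hle, this])
    · simp
  · obtain ⟨T, rfl⟩ := hP
    obtain ⟨b, hb⟩ := separation_aux T x hx
    have E1 : ∀ᶠ e in 𝓝[>] (0:ℚ), ∀ i k, crd Fan i b k + e * crd Fan i ξ k ≠ 0 := by
      rw [Filter.eventually_all]; intro i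
      rw [Filter.eventually_all]; intro k
      exact ev_ne _ _ (hgen i k)
    have E2 : ∀ᶠ e in 𝓝[>] (0:ℚ), ∀ t ∈ T, 0 < (b t - b x) + e * (ξ t - ξ x) := by
      rw [Filter.eventually_all_finset]; intro t ht
      exact ev_pos _ _ (by have := hb t ht; linarith)
    obtain ⟨e, he1, he2⟩ := (E1.and E2).exists
    set η := b + e • ξ with hη
    have hgen' : ∀ i k, crd Fan i η k ≠ 0 := by
      intro i k
      simpa [hη] using he1 i k
    have hsep : ∀ y ∈ convexHull ℚ (T : Set (Fin d → ℚ)), η x < η y := by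
      have hconv : Convex ℚ {y | η x < η y} := convex_halfSpace_gt η.isLinear _
      have hsub := convexHull_min (s := (T : Set (Fin d → ℚ))) (t := {y | η x < η y}) (by
        intro t ht
        have := he2 t ht
        simp only [hη, Set.mem_ofPred_eq, LinearMap.add_apply, LinearMap.smul_apply, smul_eq_mul]
        linarith) hconv
      exact fun y hy => hsub hy
    rw [fsum_eq Fan _ x hcomplete hfan hreg v hv hN ξ hgen,
      ← fsum_eq Fan _ x hcomplete hfan hreg v hv hN η hgen']
    rw [Finset.sum_eq_zero]
    · simp [indicator, hx]
    · intro i _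
      rw [← fterm_eq Fan x v η hgen' i]
      have : x ∉ polarCone (v i) (Fan.w i) (crd Fan i η) := by
        intro hpol
        have h1 := hsep _ (hv i)
        rw [crd_sum Fan i η] at h1
        simp only [LinearMap.sum_apply, LinearMap.smul_apply, smul_eq_mul] at h1
        refine absurd h1 (not_lt.2 (Finset.sum_le_sum fun k _ => ?_))
        obtain ⟨p1, p2⟩ := hpol k
        rcases lt_or_gt_of_ne (hgen' i k) with h | h
        · exact mul_le_mul_of_nonpos_left (p2 h).le h.le
        · exact mul_le_mul_of_nonneg_left (p1 h) h.le
      simp [indicator, this]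
end
end
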